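/- Let P = {P_n : n < ω} be a partition of ω into infinitely many infinite sets with min P_i < min P_j whenever i < j. For every finite Souslin measurable colouring c of 𝓔^P_∞ and every E ∈ 𝓔^P_∞, there exists F ∈ 𝓔^P_∞ with F ≤ E such that c is constant on 𝓔^P_∞ ↾ F = {F' ∈ 𝓔^P_∞ : F' ≤ F}. -/

import Mathlib

open Set

namespace DualRamsey

/-- `F` is a coarsening of `E` (written `F ≤ E` in the paper): every class of `F`
is a union of classes of `E`. -/
def Coarsens {X : Type*} (F E : Setoid X) : Prop := ∀ a b, E.r a b → F.r a b

/-- The set of equivalence classes of a setoid. -/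
def classes {X : Type*} (E : Setoid X) : Set (Set X) := {C | ∃ x, C = {y | E.r x y}}

/-- The set of minimal representatives of the classes of an equivalence relation on ℕ. -/
def minReps (E : Setoid ℕ) : Set ℕ := {n | ∀ m, E.r n m → n ≤ m}

/-- `pRep E k` is `p_k(E)`, the k-th minimal representative in increasing order. -/
noncomputable def pRep (E : Setoid ℕ) (k : ℕ) : ℕ := Nat.nth (· ∈ minReps E) k

/-- `approx n E` is the n-th approximation `r_n(E)`: `E` restricted to `{0,…,p_n(E)-1}`,
identified with its graph. -/
noncomputable def approx (n : ℕ) (E : Setoid ℕ) : Set (ℕ × ℕ) :=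
  {q | q.1 < pRep E n ∧ q.2 < pRep E n ∧ E.r q.1 q.2}

/-- Basic set `[a, E]` relative to a space `S` of equivalence relations. -/
noncomputable def basicSet (S : Set (Setoid ℕ)) (a : Set (ℕ × ℕ)) (E : ↥S) : Set ↥S :=
  {F | Coarsens F.1 E.1 ∧ ∃ n, approx n F.1 = a}

/-- The Ellentuck topology on a space `S` of equivalence relations. -/
noncomputable def ellentuckTop (S : Set (Setoid ℕ)) : TopologicalSpace ↥S :=
  TopologicalSpace.generateFrom {U | ∃ a E, U = basicSet S a E}

def IsRamsey (S : Set (Setoid ℕ)) (X : Set ↥S) : Prop :=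
  ∀ (a : Set (ℕ × ℕ)) (B : ↥S), (basicSet S a B).Nonempty →
    ∃ A ∈ basicSet S a B, basicSet S a A ⊆ X ∨ basicSet S a A ∩ X = ∅

def IsRamseyNull (S : Set (Setoid ℕ)) (X : Set ↥S) : Prop :=
  ∀ (a : Set (ℕ × ℕ)) (B : ↥S), (basicSet S a B).Nonempty →
    ∃ A ∈ basicSet S a B, basicSet S a A ∩ X = ∅

/-- The property of Baire with respect to the Ellentuck topology. -/
noncomputable def HasBP (S : Set (Setoid ℕ)) (X : Set ↥S) : Prop :=
  ∃ O M : Set ↥S, (ellentuckTop S).IsOpen O ∧ @IsMeagre _ (ellentuckTop S) M ∧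
    X = (O \ M) ∪ (M \ O)

/-- The Souslin operation applied to a scheme indexed by finite sequences of naturals. -/
def souslinOp {X : Type*} (A : List ℕ → Set X) : Set X :=
  ⋃ x : ℕ → ℕ, ⋂ n : ℕ, A ((List.range n).map x)

/-- `Y` belongs to the smallest field of sets containing all `t`-open sets and
closed under the Souslin operation. -/
def SouslinMeasurable {X : Type*} (t : TopologicalSpace X) (Y : Set X) : Prop :=
  ∀ 𝒜 : Set (Set X),
    (∀ U, t.IsOpen U → U ∈ 𝒜) →
    (∀ A ∈ 𝒜, Aᶜ ∈ 𝒜) →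
    (∀ A ∈ 𝒜, ∀ B ∈ 𝒜, A ∪ B ∈ 𝒜) →
    (∀ f : List ℕ → Set X, (∀ s, f s ∈ 𝒜) → souslinOp f ∈ 𝒜) →
    Y ∈ 𝒜

/-- The graph of an equivalence relation as a boolean-valued function. -/
noncomputable def graphMap {X : Type*} (E : Setoid X) : X × X → Bool :=
  fun q => @decide (E.r q.1 q.2) (Classical.dec _)

/-- The metrizable topology on a space of equivalence relations, as a subspace of
`2^(X × X)` via graphs. -/
noncomputable def graphTop {X : Type*} (S : Set (Setoid X)) : TopologicalSpace ↥S :=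
  TopologicalSpace.induced (fun E => graphMap E.1) inferInstance



/-- `σ(k)`: the largest `n` such that `2^n` divides `k+1`. -/
def sigmaSeq (k : ℕ) : ℕ := padicValNat 2 (k + 1)

/-- `𝓔^P_∞` for a partition `P` of ℕ into infinitely many infinite pieces: the
`P`-alternating equivalence relations, i.e. those with infinitely many classes whose
`k`-th minimal representative lies in `P (σ k)`. -/
noncomputable def EPaltInf (P : ℕ → Set ℕ) : Set (Setoid ℕ) :=
  {E | (classes E).Infinite ∧ ∀ k : ℕ, pRep E k ∈ P (sigmaSeq k)}

/-! ### The monoid of type-preserving rigid surjections -/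

/-- Rigid surjections of `ℕ` whose first occurrences preserve the type `τ`. -/
structure RG (τ : ℕ → ℕ) where
  toFun : ℕ → ℕ
  rigid : ∀ x j, j < toFun x → ∃ y < x, toFun y = j
  surj : ∀ k, ∃ x, toFun x = k
  typ : ∀ x, (∀ y < x, toFun y ≠ toFun x) → τ x = τ (toFun x)

namespace RG

variable {τ : ℕ → ℕ}

instance : CoeFun (RG τ) (fun _ => ℕ → ℕ) := ⟨RG.toFun⟩

theorem ext' {f g : RG τ} (h : ∀ x, f x = g x) : f = g := by
  cases f; cases g
  congr
  exact funext h

theorem rigid_le {f : ℕ → ℕ} (hf : ∀ x j, j < f x → ∃ y < x, f y = j) (x : ℕ) : f x ≤ x := by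
  induction x using Nat.strong_induction_on with
  | _ x ih =>
    rcases Nat.eq_zero_or_pos (f x) with h | h
    · omega
    · obtain ⟨y, hy, hyx⟩ := hf x (f x - 1) (by omega)
      have := ih y hy
      omega

theorem le_self (f : RG τ) (x : ℕ) : f x ≤ x := rigid_le f.rigid x

/-- values before a first occurrence are smaller. -/
theorem rigid_lt_of_first {f : ℕ → ℕ} (hf : ∀ x j, j < f x → ∃ y < x, f y = j) {p : ℕ}
    (hp : ∀ y < p, f y ≠ f p) : ∀ y < p, f y < f p := by
  intro y hy
  by_contra hcon
  have h1 : f p < f y := lt_of_le_of_ne (not_lt.mp hcon) (fun h => hp y hy h.symm)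
  obtain ⟨z, hz, hzp⟩ := hf y (f p) h1
  exact hp z (by omega) hzp

theorem exists_first {f : ℕ → ℕ} (hf : ∀ x j, j < f x → ∃ y < x, f y = j)
    (hs : ∀ k, ∃ x, f x = k) (k : ℕ) : ∃ p, f p = k ∧ ∀ y < p, f y < k := by
  classical
  refine ⟨Nat.find (hs k), Nat.find_spec (hs k), ?_⟩
  have h0 := Nat.find_spec (hs k)
  intro y hy
  have := rigid_lt_of_first hf (p := Nat.find (hs k)) (by
    intro y hy h
    exact Nat.find_min (hs k) hy (h.trans h0)) y hy
  omega

theorem exists_first' (f : RG τ) (k : ℕ) : ∃ p, f p = k ∧ ∀ y < p, f y < k :=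
  exists_first f.rigid f.surj k

instance : One (RG τ) := ⟨⟨fun x => x, fun _ j h => ⟨j, h, rfl⟩, fun k => ⟨k, rfl⟩, fun _ _ => rfl⟩⟩

instance : Mul (RG τ) := ⟨fun f g => ⟨fun x => f (g x), by
    intro x j hj
    obtain ⟨y, hy, hyj⟩ := f.rigid _ _ hj
    obtain ⟨z, hz, hzy⟩ := g.rigid _ _ hy
    exact ⟨z, hz, by rw [hzy, hyj]⟩, by
    intro k
    obtain ⟨y, hy⟩ := f.surj k
    obtain ⟨z, hz⟩ := g.surj y
    exact ⟨z, by rw [hz, hy]⟩, by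
    intro x hx
    rw [g.typ x (fun y hy h => hx y hy (by rw [h])), f.typ (g x)]
    intro y hy h
    obtain ⟨z, hz, hzy⟩ := g.rigid _ _ hy
    exact hx z hz (by rw [hzy, h])⟩⟩

@[simp] theorem one_apply (x : ℕ) : (1 : RG τ) x = x := rfl
@[simp] theorem mul_apply (f g : RG τ) (x : ℕ) : (f * g) x = f (g x) := rfl

instance : Monoid (RG τ) where
  mul_assoc _ _ _ := rfl
  one_mul _ := rfl
  mul_one _ := rfl

/-- Factoring: if `g ∘ k` is rigid and surjective and preserves types, so is `g`. -/
theorem exists_factor (k h : RG τ) (g : ℕ → ℕ) (hg : ∀ x, g (k x) = h x) :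
    ∃ g' : RG τ, ∀ x, g' x = g x := by
  refine ⟨⟨g, ?_, ?_, ?_⟩, fun _ => rfl⟩
  · intro c j hj
    obtain ⟨x, hx, hx2⟩ := k.exists_first' c
    rw [← hx, hg] at hj
    obtain ⟨y, hy, hyj⟩ := h.rigid _ _ hj
    exact ⟨k y, hx2 y hy, by rw [hg, hyj]⟩
  · intro c
    obtain ⟨x, hx⟩ := h.surj c
    exact ⟨k x, by rw [hg, hx]⟩
  · intro c hc
    obtain ⟨x, hx, hx2⟩ := k.exists_first' c
    have h1 := k.typ x (fun y hy h => by have := hx2 y hy; omega)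
    have h2 := h.typ x (fun y hy h => by
      rw [← hg, ← hg, hx] at h
      exact hc _ (hx2 y hy) h)
    rw [← hg, hx] at h2
    rw [← h2, h1, hx]

/-- `f` fixes `0, …, n`. -/
def Fix (n : ℕ) (f : RG τ) : Prop := ∀ i ≤ n, f i = i

theorem fix_one (n : ℕ) : Fix n (1 : RG τ) := fun _ _ => rfl

theorem Fix.mul {n : ℕ} {f g : RG τ} (hf : Fix n f) (hg : Fix n g) : Fix n (f * g) := by
  intro i hi
  rw [mul_apply, hg i hi, hf i hi]

theorem Fix.mono {m n : ℕ} (h : m ≤ n) {f : RG τ} (hf : Fix n f) : Fix m f :=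
  fun i hi => hf i (hi.trans h)

theorem fix_zero (f : RG τ) : Fix 0 f := by
  intro i hi
  have := f.le_self i
  omega

/-- `f` and `g` have the same `m`-th approximation, of length `d`. -/
def AgreeAt (m d : ℕ) (f g : RG τ) : Prop :=
  f d = m ∧ g d = m ∧ ∀ y < d, f y = g y ∧ f y < m

theorem AgreeAt.symm {m d : ℕ} {f g : RG τ} (h : AgreeAt m d f g) : AgreeAt m d g f :=
  ⟨h.2.1, h.1, fun y hy => ⟨(h.2.2 y hy).1.symm, by rw [← (h.2.2 y hy).1]; exact (h.2.2 y hy).2⟩⟩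

theorem AgreeAt.trans {m d : ℕ} {f g h : RG τ} (h1 : AgreeAt m d f g) (h2 : AgreeAt m d g h) :
    AgreeAt m d f h :=
  ⟨h1.1, h2.2.1, fun y hy => ⟨(h1.2.2 y hy).1.trans (h2.2.2 y hy).1, (h1.2.2 y hy).2⟩⟩

theorem AgreeAt.le {m d : ℕ} {f g : RG τ} (h : AgreeAt m d f g) : m ≤ d := by
  rw [← h.1]; exact f.le_self d

def Agree (m : ℕ) (f g : RG τ) : Prop := ∃ d, AgreeAt m d f g

theorem Agree.symm {m : ℕ} {f g : RG τ} (h : Agree m f g) : Agree m g f := by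
  obtain ⟨d, h⟩ := h
  exact ⟨d, h.symm⟩

/-- right multiplication by an element fixing `0, …, d`. -/
theorem AgreeAt.mul_fix {m d : ℕ} {f g A : RG τ} (h : AgreeAt m d f g) (hA : Fix d A) :
    AgreeAt m d (f * A) g := by
  refine ⟨by rw [mul_apply, hA d le_rfl, h.1], h.2.1, fun y hy => ?_⟩
  rw [mul_apply, hA y hy.le]
  exact h.2.2 y hy

theorem Agree.mul_right {m : ℕ} {f g : RG τ} (h : Agree m f g) (A : RG τ) :
    Agree m (f * A) (g * A) := by
  obtain ⟨d, h⟩ := h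
  obtain ⟨p, hp, hp2⟩ := A.exists_first' d
  refine ⟨p, by rw [mul_apply, hp, h.1], by rw [mul_apply, hp, h.2.1], fun y hy => ?_⟩
  exact h.2.2 _ (hp2 y hy)

theorem agree_self (m : ℕ) (f : RG τ) : Agree m f f := by
  obtain ⟨p, hp, hp2⟩ := f.exists_first' m
  exact ⟨p, hp, hp, fun y hy => ⟨rfl, hp2 y hy⟩⟩

theorem agree_fix_mul {m : ℕ} {g : RG τ} (hg : Fix m g) (f : RG τ) : Agree m (g * f) f := by
  obtain ⟨p, hp, hp2⟩ := f.exists_first' m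
  refine ⟨p, by rw [mul_apply, hp, hg m le_rfl], hp, fun y hy => ?_⟩
  rw [mul_apply, hg _ (hp2 y hy).le]
  exact ⟨rfl, hp2 y hy⟩

theorem agree_fix {m : ℕ} {g h : RG τ} (hg : Fix m g) (hh : Fix m h) : Agree m g h :=
  ⟨m, hg m le_rfl, hh m le_rfl, fun y hy => ⟨by rw [hg y hy.le, hh y hy.le], by rw [hg y hy.le]; exact hy⟩⟩

/-- counter used in the amalgamation. -/
def amalgM (τ : ℕ → ℕ) (m d : ℕ) : ℕ → ℕ
  | 0 => d
  | j + 1 => if τ (m + j + 1) = τ (amalgM τ m d j + 1) then amalgM τ m d j + 1 else amalgM τ m d j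

theorem amalgM_succ_cases (m d j : ℕ) :
    (amalgM τ m d (j + 1) = amalgM τ m d j) ∨
    (amalgM τ m d (j + 1) = amalgM τ m d j + 1 ∧ τ (m + j + 1) = τ (amalgM τ m d (j + 1))) := by
  by_cases h : τ (m + j + 1) = τ (amalgM τ m d j + 1)
  · right; simp [amalgM, h]
  · left; simp [amalgM, h]

theorem amalgM_ivt (m d : ℕ) (c j : ℕ) (hd : d ≤ j) (hj : j < amalgM τ m d c) :
    ∃ c' < c, amalgM τ m d c' = j := by
  induction c with
  | zero => simp [amalgM] at hj; omega
  | succ c ih =>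
    by_cases h : j < amalgM τ m d c
    · obtain ⟨c', hc', h'⟩ := ih h
      exact ⟨c', by omega, h'⟩
    · refine ⟨c, by omega, ?_⟩
      rcases amalgM_succ_cases (τ := τ) m d c with h1 | h1 <;> omega

theorem amalgM_mono (m d : ℕ) : Monotone (amalgM τ m d) := by
  refine monotone_nat_of_le_succ fun j => ?_
  rcases amalgM_succ_cases (τ := τ) m d j with h1 | h1 <;> omega

theorem amalgM_surj (hτ : ∀ s N, ∃ x, N < x ∧ τ x = s) (m d k : ℕ) (hk : d ≤ k) :
    ∃ c, amalgM τ m d c = k := by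
  induction k, hk using Nat.le_induction with
  | base => exact ⟨0, rfl⟩
  | succ k hk ih =>
    obtain ⟨c, hc⟩ := ih
    obtain ⟨x, hx, hxs⟩ := hτ (τ (k + 1)) (m + c)
    by_contra hcon
    push Not at hcon
    have key : ∀ e, amalgM τ m d (c + e) = k := by
      intro e
      induction e with
      | zero => exact hc
      | succ e ihe =>
        rcases amalgM_succ_cases (τ := τ) m d (c + e) with h1 | h1
        · rw [← add_assoc, h1, ihe]
        · exact absurd (by omega) (hcon (c + e + 1))
    have h1 := key (x - m - 1 - c)
    have h2 : c + (x - m - 1 - c) = x - m - 1 := by omega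
    rw [h2] at h1
    apply hcon (x - m - 1 + 1)
    have h3 : m + (x - m - 1) + 1 = x := by omega
    simp [amalgM, h1, h3, hxs]

theorem amalg (hτ : ∀ s N, ∃ x, N < x ∧ τ x = s) (m d : ℕ) (k : RG τ)
    (hk : AgreeAt m d k k) :
    ∃ A : RG τ, Fix d A ∧ ∀ f, AgreeAt m d f k → ∃ g, Fix m g ∧ f * A = g * k := by
  classical
  have hrep : ∀ c, ∃ y, k y = c ∧ ∀ z < y, k z < c := k.exists_first'
  choose rep hrep1 hrep2 using hrep
  have hrepd : ∀ c < m, rep c < d := by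
    intro c hc
    by_contra hcon
    rcases Nat.lt_or_ge d (rep c) with h | h
    · have := hrep2 c d h
      have := hk.1
      omega
    · have h3 : rep c = d := by omega
      have := hrep1 c
      rw [h3, hk.1] at this
      omega
  set M := amalgM τ m d with hM
  have hMd : ∀ c, d ≤ M c := fun c => amalgM_mono m d (Nat.zero_le c)
  let a : ℕ → ℕ := fun i => if i < d then i else if k i < m then rep (k i) else M (k i - m)
  have a1 : ∀ i, i < d → a i = i := fun i hi => if_pos hi
  have a2 : ∀ i, d ≤ i → k i < m → a i = rep (k i) := fun i hi hk => by
    simp only [a]; rw [if_neg (by omega), if_pos hk]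
  have a3 : ∀ i, d ≤ i → m ≤ k i → a i = M (k i - m) := fun i hi hk => by
    simp only [a]; rw [if_neg (by omega), if_neg (by omega)]
  have hge : ∀ y, m ≤ k y → d ≤ y := by
    intro y hy
    by_contra hcon
    have := (hk.2.2 y (by omega)).2
    omega
  let A : RG τ := ⟨a, by
    intro x j hj
    by_cases hx : x < d
    · rw [a1 x hx] at hj
      exact ⟨j, hj, a1 j (by omega)⟩
    · by_cases hkx : k x < m
      · rw [a2 x (by omega) hkx] at hj
        have := hrepd _ hkx
        exact ⟨j, by omega, a1 j (by omega)⟩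
      · rw [a3 x (by omega) (by omega)] at hj
        by_cases hjd : j < d
        · exact ⟨j, by omega, a1 j hjd⟩
        · obtain ⟨c, hc, hcj⟩ := amalgM_ivt m d _ j (by omega) hj
          obtain ⟨y, hy, hyc⟩ := k.rigid x (m + c) (by omega)
          refine ⟨y, hy, ?_⟩
          rw [a3 y (hge y (by omega)) (by omega), hyc, ← hcj]
          congr 1
          omega, by
    intro j
    by_cases hjd : j < d
    · exact ⟨j, a1 j hjd⟩
    · obtain ⟨c, hc⟩ := amalgM_surj hτ m d j (by omega)
      obtain ⟨y, hy⟩ := k.surj (m + c)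
      refine ⟨y, ?_⟩
      rw [a3 y (hge y (by omega)) (by omega), hy, ← hc]
      congr 1
      omega, by
    intro x hx
    by_cases hxd : x < d
    · rw [a1 x hxd]
    · by_cases hkx : k x < m
      · exfalso
        have h1 := hrepd _ hkx
        refine hx (rep (k x)) (by omega) ?_
        rw [a1 _ h1, a2 x (by omega) hkx]
      · rw [a3 x (by omega) (by omega)]
        have hfirst : ∀ y < x, k y ≠ k x := by
          intro y hy h
          apply hx y hy
          rw [a3 x (by omega) (by omega), a3 y (hge y (by omega)) (by omega), h]
        have ht := k.typ x hfirst
        rcases Nat.eq_zero_or_pos (k x - m) with h0 | h0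
        · have hxd' : x = d := by
            by_contra hne
            apply hfirst d (by omega)
            rw [hk.1]; omega
          rw [h0, hxd']
          rfl
        · obtain ⟨c, hc⟩ : ∃ c, k x - m = c + 1 := ⟨k x - m - 1, by omega⟩
          rcases amalgM_succ_cases (τ := τ) m d c with h1 | h1
          · exfalso
            obtain ⟨y, hy, hyc⟩ := k.rigid x (m + c) (by omega)
            apply hx y hy
            rw [a3 x (by omega) (by omega), a3 y (hge y (by omega)) (by omega), hc, hyc]
            have : m + c - m = c := by omega
            rw [this, hM, h1]
          · rw [hc, hM, ← h1.2, ht]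
            congr 1
            omega⟩
  have hA : ∀ i, A i = a i := fun _ => rfl
  refine ⟨A, ?_, ?_⟩
  · intro i hi
    rcases Nat.lt_or_ge i d with h | h
    · exact a1 i h
    · have : i = d := by omega
      subst this
      rw [hA, a3 i le_rfl (by rw [hk.1]), hk.1, Nat.sub_self]
      rfl
  · intro f hf
    let g : ℕ → ℕ := fun c => if c < m then c else f (M (c - m))
    have hgk : ∀ x, g (k x) = (f * A) x := by
      intro x
      rw [mul_apply, hA]
      by_cases hx : x < d
      · rw [a1 x hx]
        have h1 := hf.2.2 x hx
        have h2 : k x < m := by omega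
        simp only [g, if_pos h2]
        exact h1.1.symm
      · by_cases hkx : k x < m
        · rw [a2 x (by omega) hkx]
          simp only [g, if_pos hkx]
          rw [(hf.2.2 _ (hrepd _ hkx)).1, hrep1]
        · rw [a3 x (by omega) (by omega)]
          simp only [g, if_neg hkx]
    obtain ⟨g', hg'⟩ := exists_factor k (f * A) g hgk
    refine ⟨g', ?_, ext' fun x => ?_⟩
    · intro i hi
      rw [hg']
      by_cases h : i < m
      · simp only [g, if_pos h]
      · have : i = m := by omega
        simp only [g, if_neg h]
        rw [this, Nat.sub_self]
        exact hf.1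
    · rw [mul_apply (f := g'), hg', hgk]

/-- infinite compositions. -/
def itG (C : ℕ → RG τ) (j : ℕ) : ℕ → RG τ
  | 0 => 1
  | e + 1 => C (j + e) * itG C j e

theorem itG_shift (C : ℕ → RG τ) (j e : ℕ) : itG C j (e + 1) = itG C (j + 1) e * C j := by
  induction e with
  | zero => rfl
  | succ e ih =>
    rw [itG, ih, itG, mul_assoc]
    congr 2
    omega

theorem exists_limit (n : ℕ) (C : ℕ → RG τ) (hC : ∀ j, Fix (n + j) (C j)) :
    ∃ D : ℕ → RG τ, (∀ j, Fix (n + j) (D j)) ∧ ∀ j, D j = D (j + 1) * C j := by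
  have hst : ∀ j k x e, itG C j k x ≤ k → k ≤ e → itG C j e x = itG C j k x := by
    intro j k x e h1 h2
    induction e, h2 using Nat.le_induction with
    | base => rfl
    | succ e he ih =>
      rw [itG, mul_apply, ih]
      exact hC _ _ (by omega)
  have hst' : ∀ j x e, x ≤ e → itG C j e x = itG C j x x :=
    fun j x e h => hst j x x e (le_self _ _) h
  have hfix : ∀ j e, Fix (n + j) (itG C j e) := by
    intro j e
    induction e with
    | zero => exact fix_one _
    | succ e ih => exact ((hC _).mono (by omega)).mul ih
  refine ⟨fun j => ⟨fun x => itG C j x x, ?_, ?_, ?_⟩, ?_, ?_⟩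
  · intro x k hk
    obtain ⟨y, hy, hyk⟩ := (itG C j x).rigid x k hk
    exact ⟨y, hy, by rw [← hst' j y x hy.le, hyk]⟩
  · intro k
    obtain ⟨x, hx⟩ := (itG C j k).surj k
    refine ⟨x, ?_⟩
    rw [← hst' j x (max x k) (le_max_left _ _), hst j k x (max x k) (by rw [hx]) (le_max_right _ _), hx]
  · intro x hx
    refine (itG C j x).typ x fun y hy h => hx y hy ?_
    rw [← hst' j y x hy.le]
    exact h
  · intro j i hi
    exact hfix j i i hi
  · intro j
    refine ext' fun x => ?_
    change itG C j x x = itG C (j+1) (C j x) (C j x)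
    rw [← hst' j x (x + 1) (by omega), itG_shift, mul_apply]
    exact hst' _ _ _ (le_self _ _)

theorem finset_tasks {ι : Type*} (S : Finset ι) (T : ι → RG τ → Prop) (d : ℕ)
    (rob : ∀ t B A, Fix d A → T t B → T t (A * B)) (ach : ∀ t B, ∃ C, Fix d C ∧ T t (C * B))
    (B : RG τ) : ∃ C, Fix d C ∧ ∀ t ∈ S, T t (C * B) := by
  classical
  induction S using Finset.induction_on with
  | empty => exact ⟨1, fix_one d, by simp⟩
  | insert a S _ ih =>
    obtain ⟨C, hC, h⟩ := ih
    obtain ⟨C', hC', h'⟩ := ach a (C * B)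
    refine ⟨C' * C, hC'.mul hC, fun t ht => ?_⟩
    rw [mul_assoc]
    rcases Finset.mem_insert.mp ht with rfl | ht
    · exact h'
    · exact rob _ _ _ hC' (h t ht)

theorem fusion (hτ : ∀ s N, ∃ x, N < x ∧ τ x = s) (Θ : ℕ → ℕ → RG τ → Prop)
    (hered : ∀ i m B A, Fix m A → Θ i m B → Θ i m (A * B)) (n : ℕ) (B : RG τ) :
    ∃ A, Fix n A ∧ ∀ i m f f', n ≤ m → i ≤ m → Agree m f f' →
      Θ i m (f * (A * B)) → Θ i m (f' * (A * B)) := by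
  classical
  have stage : ∀ d B, ∃ C : RG τ, Fix d C ∧ ∀ i m f f', i ≤ d → AgreeAt m d f f' →
      Θ i m (f * (C * B)) → Θ i m (f' * (C * B)) := by
    intro d B
    let T : (Fin (d + 1) × Fin (d + 1) × (Fin d → Fin (d + 1))) → RG τ → Prop := fun t B =>
      ∀ f f', AgreeAt t.2.1 d f f' → (∀ y : Fin d, f y = t.2.2 y) → Θ t.1 t.2.1 (f * B) →
        Θ t.1 t.2.1 (f' * B)
    obtain ⟨C, hC, h⟩ := finset_tasks Finset.univ T d (by
      intro t B A hA h f f' hff hf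
      rw [← mul_assoc, ← mul_assoc]
      refine h _ _ ?_ ?_
      · exact ((hff.mul_fix hA).symm.mul_fix hA).symm
      · intro y
        rw [mul_apply, hA y y.2.le, hf]) (by
      intro t B
      by_cases hex : ∃ f, AgreeAt t.2.1 d f f ∧ (∀ y : Fin d, f y = t.2.2 y) ∧ Θ t.1 t.2.1 (f * B)
      · obtain ⟨k, hk, hkt, hkΘ⟩ := hex
        obtain ⟨A, hA, hAm⟩ := amalg hτ _ d k hk
        refine ⟨A, hA, fun f f' hff hf _ => ?_⟩
        have : AgreeAt t.2.1 d f' k := by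
          refine hff.symm.trans ⟨hff.1, hk.1, fun y hy => ⟨?_, (hff.2.2 y hy).2⟩⟩
          rw [hf ⟨y, hy⟩, hkt ⟨y, hy⟩]
        obtain ⟨g, hg, hgk⟩ := hAm f' this
        rw [← mul_assoc, hgk, mul_assoc]
        exact hered _ _ _ _ hg hkΘ
      · refine ⟨1, fix_one d, fun f f' hff hf h => ?_⟩
        exact absurd ⟨f, hff.trans hff.symm, hf, by simpa using h⟩ hex) B
    refine ⟨C, hC, fun i m f f' hi hff => ?_⟩
    have hm := hff.le
    exact h (⟨i, by omega⟩, ⟨m, by omega⟩, fun y => ⟨f y, by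
      have := f.le_self y
      omega⟩) (Finset.mem_univ _) f f' hff (fun y => rfl)
  choose st hst1 hst2 using stage
  let Bs : ℕ → RG τ := fun j => Nat.rec B (fun j b => st (n + j) b * b) j
  have hBs : ∀ j, Bs (j + 1) = st (n + j) (Bs j) * Bs j := fun j => rfl
  obtain ⟨D, hD1, hD2⟩ := exists_limit n (fun j => st (n + j) (Bs j)) (fun j => hst1 _ _)
  have hDB : ∀ j, D 0 * B = D j * Bs j := by
    intro j
    induction j with
    | zero => rfl
    | succ j ih => rw [ih, hBs, hD2 j, mul_assoc]
  refine ⟨D 0, hD1 0, fun i m f f' hnm him hff h => ?_⟩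
  obtain ⟨d, hff⟩ := hff
  have hmd := hff.le
  have hd : n + (d - n) = d := by omega
  rw [hDB (d - n + 1), hBs, hd, ← mul_assoc] at h ⊢
  have hfix : Fix d (D (d - n + 1)) := (hD1 (d - n + 1)).mono (by omega)
  exact hst2 d _ i m _ _ (by omega) ((hff.mul_fix hfix).symm.mul_fix hfix).symm h

/-! ### Abstract Ellentuck theory -/

/-- completely Ramsey sets. -/
def CR (X : Set (RG τ)) : Prop := ∀ n B, ∃ A, Fix n A ∧
  ((∀ f, Fix n f → f * (A * B) ∈ X) ∨ (∀ f, Fix n f → f * (A * B) ∉ X))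

def CNull (X : Set (RG τ)) : Prop := ∀ n B, ∃ A, Fix n A ∧ ∀ f, Fix n f → f * (A * B) ∉ X

def IsOp (X : Set (RG τ)) : Prop := ∀ h ∈ X, ∃ m, ∀ f, Fix m f → f * h ∈ X

def Pigeon (τ : ℕ → ℕ) : Prop := ∀ (n : ℕ) (Ψ : RG τ → Prop),
  (∀ f g, Agree (n + 1) f g → Ψ f → Ψ g) →
  ∃ A, Fix n A ∧ ((∀ f, Fix n f → Ψ (f * A)) ∨ (∀ f, Fix n f → ¬ Ψ (f * A)))

theorem CR.compl {X : Set (RG τ)} (h : CR X) : CR Xᶜ := by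
  intro n B
  obtain ⟨A, hA, h | h⟩ := h n B
  · exact ⟨A, hA, Or.inr fun f hf hc => hc (h f hf)⟩
  · exact ⟨A, hA, Or.inl fun f hf => h f hf⟩

theorem CNull.cr {X : Set (RG τ)} (h : CNull X) : CR X := by
  intro n B
  obtain ⟨A, hA, h⟩ := h n B
  exact ⟨A, hA, Or.inr h⟩

theorem CNull.mono {X Y : Set (RG τ)} (h : CNull Y) (hXY : X ⊆ Y) : CNull X := by
  intro n B
  obtain ⟨A, hA, h⟩ := h n B
  exact ⟨A, hA, fun f hf hc => h f hf (hXY hc)⟩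

theorem CR.union {X Y : Set (RG τ)} (hX : CR X) (hY : CR Y) : CR (X ∪ Y) := by
  intro n B
  obtain ⟨A, hA, h⟩ := hX n B
  obtain ⟨A', hA', h'⟩ := hY n (A * B)
  refine ⟨A' * A, hA'.mul hA, ?_⟩
  rcases h with h | h
  · left
    intro f hf
    left
    have := h (f * A') (hf.mul hA')
    simpa only [mul_assoc] using this
  · rcases h' with h' | h'
    · left
      intro f hf
      right
      simpa only [mul_assoc] using h' f hf
    · right
      intro f hf
      have h1 := h (f * A') (hf.mul hA')
      have h2 := h' f hf
      simp only [mul_assoc] at h1 h2 ⊢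
      rintro (h3 | h3)
      · exact h1 h3
      · exact h2 h3

theorem CR.inter {X Y : Set (RG τ)} (hX : CR X) (hY : CR Y) : CR (X ∩ Y) := by
  have := (hX.compl.union hY.compl).compl
  rwa [← Set.compl_inter, compl_compl] at this

theorem CR.diff {X Y : Set (RG τ)} (hX : CR X) (hY : CR Y) : CR (X \ Y) := by
  rw [Set.sdiff_eq]
  exact hX.inter hY.compl

theorem cr_of_open (hτ : ∀ s N, ∃ x, N < x ∧ τ x = s) (hP : Pigeon τ) {X : Set (RG τ)}
    (hX : IsOp X) : CR X := by
  intro n B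
  let Θ : ℕ → RG τ → Prop := fun m B => ∀ f, Fix m f → f * B ∈ X
  have hΘ : ∀ m B A, Fix m A → Θ m B → Θ m (A * B) := by
    intro m B A hA h f hf
    rw [← mul_assoc]
    exact h _ (hf.mul hA)
  have hΘm : ∀ m m' B, m ≤ m' → Θ m B → Θ m' B := fun m m' B hm h f hf => h f (hf.mono hm)
  obtain ⟨A₁, hA₁, h₁⟩ := fusion hτ (fun _ => Θ) (fun _ => hΘ) n B
  let B₁ := A₁ * B
  let Θ₂ : ℕ → RG τ → Prop := fun m B => Θ m B ∨ ∀ g, Fix m g → ¬ Θ (m + 1) (g * B)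
  obtain ⟨A₂, hA₂, h₂⟩ := fusion hτ (fun _ => Θ₂) (by
    intro _ m B A hA h
    rcases h with h | h
    · exact Or.inl (hΘ _ _ _ hA h)
    · right
      intro g hg
      rw [← mul_assoc]
      exact h _ (hg.mul hA)) n B₁
  by_cases hacc : Θ n (A₂ * B₁)
  · refine ⟨A₂ * A₁, hA₂.mul hA₁, Or.inl fun f hf => ?_⟩
    rw [mul_assoc]
    exact hacc f hf
  · refine ⟨A₂ * A₁, hA₂.mul hA₁, Or.inr fun f hf => ?_⟩
    have hall : ∀ m, n ≤ m → ∀ f, Fix n f → Θ₂ m (f * (A₂ * B₁)) := by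
      intro m hm f hf
      have : ∃ g, Fix m g ∧ Θ₂ m (g * (f * (A₂ * B₁))) := by
        by_cases hacc' : Θ m (f * (A₂ * B₁))
        · exact ⟨1, fix_one m, Or.inl hacc'⟩
        · obtain ⟨A, hA, h | h⟩ := hP m (fun g => Θ (m + 1) (g * (f * (A₂ * B₁)))) (by
            intro g g' hgg
            have := h₁ 0 (m + 1) (g * (f * A₂)) (g' * (f * A₂)) (by omega) (by omega)
              (hgg.mul_right _)
            simpa only [mul_assoc, B₁] using this)
          · exfalso
            apply hacc'
            have h3 : Θ m (A * (f * (A₂ * B₁))) := by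
              intro g hg
              have := h g hg 1 (fix_one _)
              simpa only [mul_assoc, one_mul] using this
            have := h₁ 0 m (A * (f * A₂)) (f * A₂) (by omega) (by omega) (agree_fix_mul hA _)
            simp only [mul_assoc, B₁] at this h3 ⊢
            exact this h3
          · refine ⟨A, hA, Or.inr fun g hg => ?_⟩
            have := h g hg
            simpa only [mul_assoc] using this
      obtain ⟨g, hg, h⟩ := this
      have h3 := h₂ 0 m (g * f) f hm (by omega) (agree_fix_mul hg _)
      rw [mul_assoc] at h3
      exact h3 h
    have hrej : ∀ m, n ≤ m → ∀ f, Fix n f → ¬ Θ m (f * (A₂ * B₁)) := by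
      intro m hm
      induction m, hm using Nat.le_induction with
      | base =>
        intro f hf hc
        apply hacc
        have := h₁ 0 n (f * A₂) A₂ le_rfl (by omega) (agree_fix_mul hf _)
        simp only [mul_assoc, B₁] at this hc ⊢
        exact this hc
      | succ m hm ih =>
        intro f hf
        rcases hall m hm f hf with h | h
        · exact absurd h (ih f hf)
        · have := h 1 (fix_one _)
          rwa [one_mul] at this
    intro hc
    rw [mul_assoc] at hc
    obtain ⟨m, hm⟩ := hX _ hc
    exact hrej (max n m) (le_max_left _ _) f hf (hΘm m _ _ (le_max_right _ _) hm)

theorem cnull_iUnion (hτ : ∀ s N, ∃ x, N < x ∧ τ x = s) {X : ℕ → Set (RG τ)}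
    (hX : ∀ i, CNull (X i)) : CNull (⋃ i, X i) := by
  intro n B
  obtain ⟨A, hA, h⟩ := fusion hτ (fun i m B => ∀ f, Fix m f → f * B ∉ X i) (by
    intro i m B A hA h f hf
    rw [← mul_assoc]
    exact h _ (hf.mul hA)) n B
  refine ⟨A, hA, fun f hf hc => ?_⟩
  obtain ⟨i, hi⟩ := Set.mem_iUnion.mp hc
  obtain ⟨g, hg, hg'⟩ := hX i (max n i) (f * (A * B))
  have := h i (max n i) (g * f) f (le_max_left _ _) (le_max_right _ _) (agree_fix_mul hg _)
    (by rw [mul_assoc]; exact hg') 1 (fix_one _)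
  exact this (by rwa [one_mul])

theorem cr_iUnion (hτ : ∀ s N, ∃ x, N < x ∧ τ x = s) (hP : Pigeon τ) {X : ℕ → Set (RG τ)}
    (hX : ∀ i, CR (X i)) : CR (⋃ i, X i) := by
  intro n B
  obtain ⟨A, hA, h⟩ := fusion hτ (fun i m B =>
      (∀ f, Fix m f → f * B ∈ X i) ∨ (∀ f, Fix m f → f * B ∉ X i)) (by
    intro i m B A hA h
    rcases h with h | h
    · left; intro f hf
      rw [← mul_assoc]
      exact h _ (hf.mul hA)
    · right; intro f hf
      rw [← mul_assoc]
      exact h _ (hf.mul hA)) n B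
  let O : Set (RG τ) := {h | ∃ i m, ∀ f, Fix m f → f * h ∈ X i}
  have hO : IsOp O := by
    rintro h ⟨i, m, hh⟩
    refine ⟨m, fun f hf => ⟨i, m, fun g hg => ?_⟩⟩
    rw [← mul_assoc]
    exact hh _ (hg.mul hf)
  have key : ∀ f, Fix n f → (f * (A * B) ∈ O ↔ f * (A * B) ∈ ⋃ i, X i) := by
    intro f hf
    constructor
    · rintro ⟨i, m, hh⟩
      refine Set.mem_iUnion.mpr ⟨i, ?_⟩
      have := hh 1 (fix_one _)
      rwa [one_mul] at this
    · intro hc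
      obtain ⟨i, hi⟩ := Set.mem_iUnion.mp hc
      obtain ⟨g, hg, hg'⟩ := hX i (max n i) (f * (A * B))
      have := h i (max n i) (g * f) f (le_max_left _ _) (le_max_right _ _) (agree_fix_mul hg _)
        (by rw [mul_assoc]; exact hg')
      rcases this with h | h
      · exact ⟨i, _, h⟩
      · exact absurd hi (by
          have := h 1 (fix_one _)
          rwa [one_mul] at this)
  obtain ⟨A', hA', h'⟩ := cr_of_open hτ hP hO n (A * B)
  refine ⟨A' * A, hA'.mul hA, ?_⟩
  rcases h' with h' | h'
  · left
    intro f hf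
    have h1 := (key (f * A') (hf.mul hA')).1 (by
      have := h' f hf
      simpa only [mul_assoc] using this)
    simpa only [mul_assoc] using h1
  · right
    intro f hf hc
    apply h' f hf
    have h1 := (key (f * A') (hf.mul hA')).2 (by
      simpa only [mul_assoc] using hc)
    simpa only [mul_assoc] using h1

/-- closure of a set in the Ellentuck topology. -/
def Cl (Y : Set (RG τ)) : Set (RG τ) := {h | ∀ m, ∃ f, Fix m f ∧ f * h ∈ Y}

theorem subset_Cl (Y : Set (RG τ)) : Y ⊆ Cl Y := fun h hh m => ⟨1, fix_one m, by rwa [one_mul]⟩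

theorem cr_Cl (hτ : ∀ s N, ∃ x, N < x ∧ τ x = s) (hP : Pigeon τ) (Y : Set (RG τ)) : CR (Cl Y) := by
  have : IsOp (Cl Y)ᶜ := by
    intro h hh
    simp only [Cl, Set.mem_compl_iff, Set.mem_ofPred_eq] at hh
    push Not at hh
    obtain ⟨m, hm⟩ := hh
    refine ⟨m, fun f hf hc => ?_⟩
    obtain ⟨g, hg, hgY⟩ := hc m
    rw [← mul_assoc] at hgY
    exact hm _ (hg.mul hf) hgY
  have := (cr_of_open hτ hP this).compl
  rwa [compl_compl] at this

theorem cnull_of_subset_Cl_diff {Y Z : Set (RG τ)} (hZ : CR Z) (h : Z ⊆ Cl Y \ Y) : CNull Z := by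
  intro n B
  obtain ⟨A, hA, h' | h'⟩ := hZ n B
  · exfalso
    have h1 := (h (h' 1 (fix_one n))).1
    rw [one_mul] at h1
    obtain ⟨f, hf, hfY⟩ := h1 n
    exact (h (h' f hf)).2 hfY
  · exact ⟨A, hA, h'⟩

theorem cr_souslin (hτ : ∀ s N, ∃ x, N < x ∧ τ x = s) (hP : Pigeon τ)
    (X : List ℕ → Set (RG τ)) (hX : ∀ s, CR (X s)) : CR (souslinOp X) := by
  let pre : (ℕ → ℕ) → ℕ → List ℕ := fun x n => (List.range n).map x
  let Y : List ℕ → Set (RG τ) := fun s =>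
    {h | ∃ x : ℕ → ℕ, pre x s.length = s ∧ ∀ n, h ∈ X (pre x n)}
  have hYX : ∀ s, Y s ⊆ X s := by
    rintro s h ⟨x, hx, hh⟩
    have := hh s.length
    rwa [hx] at this
  have hYU : ∀ s, Y s ⊆ ⋃ i, Y (s ++ [i]) := by
    rintro s h ⟨x, hx, hh⟩
    refine Set.mem_iUnion.mpr ⟨x s.length, x, ?_, hh⟩
    simp only [pre, List.length_append, List.length_singleton, List.range_succ, List.map_append,
      List.map_singleton]
    congr 1
  have hY0 : souslinOp X = Y [] := by
    ext h
    simp [souslinOp, Y, pre]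
  let V : List ℕ → Set (RG τ) := fun s => Cl (Y s) ∩ X s
  have hV : ∀ s, CR (V s) := fun s => (cr_Cl hτ hP _).inter (hX s)
  have hYV : ∀ s, Y s ⊆ V s := fun s h hh => ⟨subset_Cl _ hh, hYX s hh⟩
  let M : List ℕ → Set (RG τ) := fun s => V s \ ⋃ i, V (s ++ [i])
  have hM : ∀ s, CNull (M s) := by
    intro s
    refine cnull_of_subset_Cl_diff (Y := Y s) ((hV s).diff (cr_iUnion hτ hP fun i => hV _)) ?_
    rintro h ⟨h1, h2⟩
    refine ⟨h1.1, fun h3 => h2 ?_⟩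
    obtain ⟨i, hi⟩ := Set.mem_iUnion.mp (hYU s h3)
    exact Set.mem_iUnion.mpr ⟨i, hYV _ hi⟩
  have hN : CNull (⋃ i : ℕ, M (Denumerable.ofNat (List ℕ) i)) := cnull_iUnion hτ fun i => hM _
  have hsub : V [] \ Y [] ⊆ ⋃ i : ℕ, M (Denumerable.ofNat (List ℕ) i) := by
    rintro h ⟨h1, h2⟩
    by_contra hcon
    apply h2
    have hstep : ∀ s, h ∈ V s → ∃ i, h ∈ V (s ++ [i]) := by
      intro s hs
      by_contra hc
      apply hcon
      refine Set.mem_iUnion.mpr ⟨Encodable.encode s, ?_⟩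
      rw [Denumerable.ofNat_encode]
      exact ⟨hs, fun h4 => hc (Set.mem_iUnion.mp h4)⟩
    choose! nx hnx using hstep
    let sq : ℕ → List ℕ := fun n => Nat.rec [] (fun _ s => s ++ [nx s]) n
    have hsq : ∀ n, sq (n + 1) = sq n ++ [nx (sq n)] := fun n => rfl
    have hsqV : ∀ n, h ∈ V (sq n) := by
      intro n
      induction n with
      | zero => exact h1
      | succ n ih => rw [hsq]; exact hnx _ ih
    have hpre : ∀ n, pre (fun n => nx (sq n)) n = sq n := by
      intro n
      induction n with
      | zero => rfl
      | succ n ih =>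
        rw [hsq, ← ih]
        simp only [pre, List.range_succ, List.map_append, List.map_singleton]
        congr 2
        rw [← ih]
    refine ⟨fun n => nx (sq n), by simp [pre], fun n => ?_⟩
    rw [hpre]
    exact (hsqV n).2
  have : Y [] = V [] \ (V [] \ Y []) := by
    rw [Set.sdiff_sdiff_cancel_left (hYV _)]
  rw [hY0, this]
  exact (hV _).diff (hN.mono hsub).cr

end RG

/-! ### Located words and the left-variable Hales-Jewett theorem -/

/-- Finite partial functions from `ℕ`. -/
structure LW (α : Type) where
  val : ℕ → Option α
  bdd : ∃ N, ∀ x, N < x → val x = none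

namespace LW

variable {α β γ : Type}

theorem ext' {u v : LW α} (h : ∀ x, u.1 x = v.1 x) : u = v := by
  cases u; cases v
  congr
  exact funext h

instance : Mul (LW α) := ⟨fun u v => ⟨fun x => (u.1 x).or (v.1 x), by
  obtain ⟨N, hN⟩ := u.2
  obtain ⟨M, hM⟩ := v.2
  refine ⟨max N M, fun x hx => ?_⟩
  change (u.1 x).or (v.1 x) = none
  rw [hN x (lt_of_le_of_lt (le_max_left _ _) hx), hM x (lt_of_le_of_lt (le_max_right _ _) hx)]
  rfl⟩⟩

theorem mul_val (u v : LW α) (x : ℕ) : (u * v).1 x = (u.1 x).or (v.1 x) := rfl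

instance : Semigroup (LW α) where
  mul_assoc u v w := ext' fun x => by simp only [mul_val, Option.or_assoc]

noncomputable instance : Semigroup (Ultrafilter (LW α)) := Ultrafilter.semigroup

/-- letterwise substitution. -/
def map (f : α → β) (u : LW α) : LW β := ⟨fun x => (u.1 x).map f, by
  obtain ⟨N, hN⟩ := u.2
  exact ⟨N, fun x hx => by change (u.1 x).map f = none; rw [hN x hx]; rfl⟩⟩

theorem map_val (f : α → β) (u : LW α) (x : ℕ) : (map f u).1 x = (u.1 x).map f := rfl

theorem map_mul (f : α → β) (u v : LW α) : map f (u * v) = map f u * map f v :=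
  ext' fun x => by
    simp only [map_val, mul_val]
    cases u.1 x <;> simp

theorem map_map (f : α → β) (g : β → γ) (u : LW α) : map g (map f u) = map (g ∘ f) u :=
  ext' fun x => by simp only [map_val, Option.map_map]

/-- substitution of a letter for the variable. -/
def sub (a : α) (w : LW (Option α)) : LW α := map (fun o => o.getD a) w

theorem sub_mul (a : α) (u v : LW (Option α)) : sub a (u * v) = sub a u * sub a v := map_mul _ _ _

theorem sub_some (a : α) (u : LW α) : sub a (map some u) = u :=
  ext' fun x => by
    simp only [sub, map_val]
    cases u.1 x <;> simp

/-- `w` is a variable word beyond `N` whose first variable is at `q`, of type `s`. -/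
def VLine (τ : ℕ → ℕ) (s N : ℕ) (w : LW (Option α)) (q : ℕ) : Prop :=
  N < q ∧ τ q = s ∧ w.1 q = some none ∧ (∀ x ≤ N, w.1 x = none) ∧ ∀ x < q, w.1 x ≠ some none

theorem VLine.mono {τ : ℕ → ℕ} {s N M : ℕ} {w : LW (Option α)} {q : ℕ} (h : VLine τ s N w q)
    (hM : M ≤ N) : VLine τ s M w q :=
  ⟨lt_of_le_of_lt hM h.1, h.2.1, h.2.2.1, fun x hx => h.2.2.2.1 x (hx.trans hM), h.2.2.2.2⟩

/-- ultrafilters all of whose members contain lines of type `s`. -/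
def LI (α : Type) (τ : ℕ → ℕ) (s : ℕ) : Set (Ultrafilter (LW α)) :=
  {p | ∀ D ∈ p, ∀ N, ∃ w q, VLine τ s N w q ∧ ∀ a, sub a w ∈ D}

theorem LI_closed (τ : ℕ → ℕ) (s : ℕ) : IsClosed (LI α τ s) := by
  have : LI α τ s = ⋂ D : {D : Set (LW α) // ¬ ∀ N, ∃ w q, VLine τ s N w q ∧ ∀ a, sub a w ∈ D},
      {p : Ultrafilter (LW α) | D.1 ∈ p}ᶜ := by
    ext p
    simp only [LI, Set.mem_iInter]
    constructor
    · intro h D hD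
      exact D.2 (h D.1 hD)
    · intro h D hD
      by_contra hc
      exact h ⟨D, hc⟩ hD
  rw [this]
  exact isClosed_iInter fun D => (ultrafilter_isOpen_basic _).isClosed_compl


def Far (p : Ultrafilter (LW α)) : Prop := ∀ N, ∀ᶠ x in (p : Filter (LW α)), ∀ i ≤ N, x.1 i = none

theorem LI_far [Nonempty α] {τ : ℕ → ℕ} {s : ℕ} {p : Ultrafilter (LW α)} (hp : p ∈ LI α τ s) :
    Far p := by
  intro N
  by_contra hc
  obtain ⟨w, q, hw, hwD⟩ := hp _ (Ultrafilter.eventually_not.2 hc) N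
  obtain ⟨a⟩ := ‹Nonempty α›
  apply hwD a
  intro i hi
  rw [sub, map_val, hw.2.2.2.1 i hi]
  rfl

theorem LI_left (τ : ℕ → ℕ) (s : ℕ) (r p : Ultrafilter (LW α)) (hr : Far r) (hp : p ∈ LI α τ s) :
    r * p ∈ LI α τ s := by
  intro D hD N
  have h1 : ∀ᶠ x in (r : Filter (LW α)), ∀ᶠ y in (p : Filter (LW α)), x * y ∈ D :=
    (Ultrafilter.eventually_mul r p (· ∈ D)).1 hD
  obtain ⟨x, hx, hxN⟩ := (h1.and (hr N)).exists
  obtain ⟨M, hM⟩ := x.2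
  obtain ⟨w, q, hw, hwD⟩ := hp _ hx (max N M)
  have hq1 := lt_of_le_of_lt (le_max_left N M) hw.1
  have hq2 := lt_of_le_of_lt (le_max_right N M) hw.1
  refine ⟨map some x * w, q, ⟨hq1, hw.2.1, ?_, ?_, ?_⟩, ?_⟩
  · rw [mul_val, map_val, hM q hq2, hw.2.2.1]; rfl
  · intro i hi
    rw [mul_val, map_val, hxN i hi, hw.2.2.2.1 i (hi.trans (le_max_left _ _))]; rfl
  · intro i hi
    rw [mul_val, map_val]
    cases h : x.1 i with
    | none => exact hw.2.2.2.2 i hi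
    | some a => simp
  · intro a
    rw [sub_mul, sub_some]
    exact hwD a

theorem LI_right [Finite α] (τ : ℕ → ℕ) (s : ℕ) (p r : Ultrafilter (LW α)) (hr : Far r)
    (hp : p ∈ LI α τ s) : p * r ∈ LI α τ s := by
  intro D hD N
  have h1 : ∀ᶠ x in (p : Filter (LW α)), ∀ᶠ y in (r : Filter (LW α)), x * y ∈ D :=
    (Ultrafilter.eventually_mul p r (· ∈ D)).1 hD
  obtain ⟨w, q, hw, hwD⟩ := hp _ h1 N
  have h2 : ∀ᶠ y in (r : Filter (LW α)), ∀ a, sub a w * y ∈ D := Filter.eventually_all.2 hwD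
  obtain ⟨y, hy, hyN⟩ := (h2.and (hr N)).exists
  refine ⟨w * map some y, q, ⟨hw.1, hw.2.1, ?_, ?_, ?_⟩, ?_⟩
  · rw [mul_val, hw.2.2.1]; rfl
  · intro i hi
    rw [mul_val, map_val, hyN i hi, hw.2.2.2.1 i hi]; rfl
  · intro i hi
    have := hw.2.2.2.2 i hi
    rw [mul_val, map_val]
    cases h : w.1 i with
    | none => cases y.1 i <;> simp
    | some a => rw [h] at this; simpa using this
  · intro a
    rw [sub_mul, sub_some]
    exact hy a

/-- The Hales-Jewett theorem for located words. -/
theorem hj_located [Finite α] (τ : ℕ → ℕ) (hτ : ∀ s N, ∃ x, N < x ∧ τ x = s) (s : ℕ)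
    {κ : Type} [Finite κ] (col : LW α → κ) (N : ℕ) :
    ∃ w q, VLine τ s N w q ∧ ∃ c, ∀ a, col (sub a w) = c := by
  classical
  obtain ⟨ι, hι, hHJ⟩ := Combinatorics.Line.exists_mono_in_high_dimension α κ
  have hinf : {x | N < x ∧ τ x = s}.Infinite := by
    rw [Set.infinite_iff_exists_gt]
    intro M
    obtain ⟨x, hx, hxs⟩ := hτ s (max N M)
    exact ⟨x, ⟨lt_of_le_of_lt (le_max_left _ _) hx, hxs⟩, lt_of_le_of_lt (le_max_right _ _) hx⟩
  have := hinf.to_subtype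
  let e : ι → ℕ := fun i => (Infinite.natEmbedding {x | N < x ∧ τ x = s} (Fintype.equivFin ι i) : ℕ)
  have he : Function.Injective e := by
    intro i j h
    have h1 := (Infinite.natEmbedding {x | N < x ∧ τ x = s}).injective (Subtype.ext h)
    exact (Fintype.equivFin ι).injective (Fin.ext h1)
  have heN : ∀ i, N < e i ∧ τ (e i) = s := fun i =>
    (Infinite.natEmbedding {x | N < x ∧ τ x = s} (Fintype.equivFin ι i)).2
  have mk : ∀ {δ : Type} (v : ι → δ), ∃ w : LW δ, (∀ i, w.1 (e i) = some (v i)) ∧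
      ∀ x, (∀ i, e i ≠ x) → w.1 x = none := by
    intro δ v
    refine ⟨⟨fun x => if h : ∃ i, e i = x then some (v h.choose) else none, ?_⟩, ?_, ?_⟩
    · obtain ⟨M, hM⟩ := (Set.finite_range e).bddAbove
      refine ⟨M, fun x hx => dif_neg ?_⟩
      rintro ⟨i, hi⟩
      have := hM ⟨i, hi⟩
      omega
    · intro i
      have h : ∃ j, e j = e i := ⟨i, rfl⟩
      change (if h : ∃ j, e j = e i then some (v h.choose) else none) = _
      rw [dif_pos h, he h.choose_spec]
    · intro x hx
      exact dif_neg (by rintro ⟨i, hi⟩; exact hx i hi)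
  choose mkα hmk1 hmk2 using fun v : ι → α => mk v
  obtain ⟨l, c, hl⟩ := hHJ (fun v => col (mkα v))
  obtain ⟨w, hw1, hw2⟩ := mk l.idxFun
  have hex : ∃ x, w.1 x = some none := by
    obtain ⟨i, hi⟩ := l.proper
    exact ⟨e i, by rw [hw1, hi]⟩
  have hran : ∀ x y, w.1 x = some y → ∃ i, e i = x := by
    intro x y h
    by_contra hc
    rw [hw2 x (fun i hi => hc ⟨i, hi⟩)] at h
    cases h
  obtain ⟨i, hi⟩ := hran _ _ (Nat.find_spec hex)
  refine ⟨w, Nat.find hex, ⟨?_, ?_, Nat.find_spec hex, ?_, ?_⟩, c, fun a => ?_⟩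
  · rw [← hi]; exact (heN i).1
  · rw [← hi]; exact (heN i).2
  · intro x hx
    apply hw2
    intro i hi
    have := (heN i).1
    omega
  · intro x hx
    exact Nat.find_min hex hx
  · rw [← hl a]
    congr 1
    refine ext' fun x => ?_
    by_cases hx : ∃ i, e i = x
    · obtain ⟨i, rfl⟩ := hx
      rw [sub, map_val, hw1, hmk1]
      rfl
    · push Not at hx
      rw [sub, map_val, hw2 x hx, hmk2 _ x hx]
      rfl

theorem LI_nonempty [Finite α] (τ : ℕ → ℕ) (hτ : ∀ s N, ∃ x, N < x ∧ τ x = s) (s : ℕ) :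
    (LI α τ s).Nonempty := by
  classical
  let S : Set (Set (LW α)) := {D | ∃ N, ¬ ∃ w q, VLine τ s N w q ∧ ∀ a, sub a w ∈ Dᶜ}
  have hne : Filter.NeBot (Filter.generate S) := by
    rw [Filter.generate_neBot_iff]
    intro T hTS hT
    by_contra hc
    rw [Set.not_nonempty_iff_eq_empty] at hc
    have hcol : ∀ u : LW α, ∃ D : T, u ∉ D.1 := by
      intro u
      by_contra hcon
      push Not at hcon
      have : u ∈ ⋂₀ T := fun D hD => hcon ⟨D, hD⟩
      rw [hc] at this
      exact this
    choose col hcol using hcol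
    have := hT.to_subtype
    have hN : ∀ D : T, ∃ N, ¬ ∃ w q, VLine τ s N w q ∧ ∀ a, sub a w ∈ D.1ᶜ := fun D => hTS D.2
    choose N hN using hN
    obtain ⟨M, hM⟩ := (Set.finite_range N).bddAbove
    obtain ⟨w, q, hw, D, hD⟩ := hj_located τ hτ s col M
    refine hN D ⟨w, q, hw.mono (hM ⟨D, rfl⟩), fun a => ?_⟩
    rw [← hD a]
    exact hcol _
  refine ⟨Ultrafilter.of (Filter.generate S), fun D hD N => ?_⟩
  by_contra hc
  have h1 : Dᶜ ∈ S := ⟨N, by rwa [compl_compl]⟩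
  have h2 : Dᶜ ∈ Ultrafilter.of (Filter.generate S) :=
    Ultrafilter.of_le _ (Filter.mem_generate_of_mem h1)
  exact Ultrafilter.compl_mem_iff_notMem.1 h2 hD

theorem exists_good_idempotent [Finite α] [Nonempty α] (τ : ℕ → ℕ)
    (hτ : ∀ s N, ∃ x, N < x ∧ τ x = s) :
    ∃ p : Ultrafilter (LW α), p * p = p ∧ ∀ s, p ∈ LI α τ s := by
  have hne : (⋂ s, ⋂ j ≤ s, LI α τ j).Nonempty := by
    refine IsCompact.nonempty_iInter_of_sequence_nonempty_isCompact_isClosed _ ?_ ?_ ?_ ?_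
    · intro s p hp
      simp only [Set.mem_iInter] at hp ⊢
      exact fun j hj => hp j (by omega)
    · intro s
      induction s with
      | zero =>
        obtain ⟨p, hp⟩ := LI_nonempty (α := α) τ hτ 0
        refine ⟨p, ?_⟩
        simp only [Set.mem_iInter]
        intro j hj
        obtain rfl : j = 0 := by omega
        exact hp
      | succ s ih =>
        obtain ⟨p, hp⟩ := ih
        simp only [Set.mem_iInter] at hp
        obtain ⟨r, hr⟩ := LI_nonempty (α := α) τ hτ (s + 1)
        refine ⟨p * r, ?_⟩
        simp only [Set.mem_iInter]
        intro j hj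
        by_cases hjs : j ≤ s
        · exact LI_right τ j p r (LI_far hr) (hp j hjs)
        · obtain rfl : j = s + 1 := by omega
          exact LI_left τ _ p r (LI_far (hp 0 (by omega))) hr
    · exact (isClosed_iInter fun j => isClosed_iInter fun _ => LI_closed τ j).isCompact
    · intro s
      exact isClosed_iInter fun j => isClosed_iInter fun _ => LI_closed τ j
  have hmem : ∀ p, p ∈ (⋂ s, ⋂ j ≤ s, LI α τ j) ↔ ∀ s, p ∈ LI α τ s := by
    intro p
    simp only [Set.mem_iInter]
    exact ⟨fun h s => h s s le_rfl, fun h s j _ => h j⟩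
  obtain ⟨p, hp, hpp⟩ := exists_idempotent_in_compact_subsemigroup
    (M := Ultrafilter (LW α)) Ultrafilter.continuous_mul_left (⋂ s, ⋂ j ≤ s, LI α τ j) hne
    (isClosed_iInter fun s => isClosed_iInter fun j => isClosed_iInter fun _ =>
      LI_closed τ j).isCompact (by
    intro x hx y hy
    rw [hmem] at hx hy ⊢
    exact fun s => LI_left τ s x y (LI_far (hx 0)) (hy s))
  exact ⟨p, hpp, (hmem p).1 hp⟩

/-- An ultrafilter of lines of type `t` all of whose instances converge to `p`. -/
theorem exists_line_ultrafilter (τ : ℕ → ℕ) (t : ℕ) (p : Ultrafilter (LW α))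
    (hp : p ∈ LI α τ t) :
    ∃ Q : Ultrafilter (LW (Option α) × ℕ),
      ∀ D ∈ p, ∀ N, ∀ᶠ wq in (Q : Filter (LW (Option α) × ℕ)),
        VLine τ t N wq.1 wq.2 ∧ ∀ a, sub a wq.1 ∈ D := by
  let F : Filter (LW (Option α) × ℕ) :=
    { sets := {S | ∃ D ∈ p, ∃ N, {wq | VLine τ t N wq.1 wq.2 ∧ ∀ a, sub a wq.1 ∈ D} ⊆ S}
      univ_sets := ⟨Set.univ, Filter.univ_mem, 0, Set.subset_univ _⟩
      sets_of_superset := by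
        rintro S S' ⟨D, hD, N, h⟩ hSS
        exact ⟨D, hD, N, h.trans hSS⟩
      inter_sets := by
        rintro S S' ⟨D, hD, N, h⟩ ⟨D', hD', N', h'⟩
        refine ⟨D ∩ D', Filter.inter_mem hD hD', max N N', ?_⟩
        rintro wq ⟨h1, h2⟩
        exact ⟨h ⟨h1.mono (le_max_left _ _), fun a => (h2 a).1⟩,
          h' ⟨h1.mono (le_max_right _ _), fun a => (h2 a).2⟩⟩ }
  have hF : F.NeBot := by
    rw [Filter.neBot_iff]
    intro hbot
    have : (∅ : Set (LW (Option α) × ℕ)) ∈ F := by rw [hbot]; exact Filter.mem_bot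
    obtain ⟨D, hD, N, h⟩ := this
    obtain ⟨w, q, hw⟩ := hp D hD N
    exact h (show (w, q) ∈ _ from hw)
  refine ⟨Ultrafilter.of F, fun D hD N => Ultrafilter.of_le F ?_⟩
  exact ⟨D, hD, N, fun _ h => h⟩

end LW


/-! ### The pigeonhole principle -/

namespace RG

open LW

variable {τ : ℕ → ℕ}

/-- The invariant of the recursive construction. -/
def Inv {n : ℕ} (As : Set (LW (Fin (n + 1)))) (c : ℕ) (s : LW ℕ × ℕ) : Prop :=
  (∀ x, s.2 < x → s.1.1 x = none) ∧ (∀ x v, s.1.1 x = some v → v < c) ∧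
    ∀ f : ℕ → Fin (n + 1), (∀ l : Fin (n + 1), f l = l) → LW.map f s.1 ∈ As

/-- One step of the recursive construction. -/
def Step {n : ℕ} (τ : ℕ → ℕ) (Cb : LW (Fin (n + 1)) → ℕ → Prop) (t c : ℕ)
    (s s' : LW ℕ × ℕ) (q : ℕ) : Prop :=
  s.2 < q ∧ q ≤ s'.2 ∧ τ q = τ c ∧ (∀ x ≤ s.2, s'.1.1 x = s.1.1 x) ∧ s'.1.1 q = some c ∧
    (∀ x < q, s'.1.1 x ≠ some c) ∧
    (τ c = t → ∀ f : ℕ → Fin (n + 1), (∀ l : Fin (n + 1), f l = l) → f c = 0 →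
      Cb (LW.map f s'.1) q)

theorem step_exists {n t : ℕ} {As : Set (LW (Fin (n + 1)))} {p : Ultrafilter (LW (Fin (n + 1)))}
    (hp : ∀ s, p ∈ LI (Fin (n + 1)) τ s)
    (hAs : ∀ z ∈ As, ∀ᶠ y in (p : Filter (LW (Fin (n + 1)))), z * y ∈ As)
    {Q : Ultrafilter (LW (Option (Fin (n + 1))) × ℕ)}
    (hQ : ∀ D ∈ p, ∀ N, ∀ᶠ wq in (Q : Filter (LW (Option (Fin (n + 1))) × ℕ)),
        VLine τ t N wq.1 wq.2 ∧ ∀ a, sub a wq.1 ∈ D)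
    {Cb : LW (Fin (n + 1)) → ℕ → Prop}
    (hC : ∀ z ∈ As, ∀ᶠ wq in (Q : Filter (LW (Option (Fin (n + 1))) × ℕ)),
      Cb (z * sub 0 wq.1) wq.2)
    {c : ℕ} (hc : n < c) (s : LW ℕ × ℕ) (hs : Inv As c s) :
    ∃ s' q, Inv As (c + 1) s' ∧ Step τ Cb t c s s' q := by
  obtain ⟨u, N⟩ := s
  obtain ⟨h1, h2, h3⟩ := hs
  simp only at h1 h2 h3
  have hfin : (Set.range fun f : ℕ → Fin (n + 1) => LW.map f u).Finite := by
    refine (Set.finite_range (fun g : Fin c → Fin (n + 1) =>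
      LW.map (fun i => if h : i < c then g ⟨i, h⟩ else 0) u)).subset ?_
    rintro _ ⟨f, rfl⟩
    refine ⟨fun i => f i, LW.ext' fun x => ?_⟩
    simp only [map_val]
    cases hx : u.1 x with
    | none => rfl
    | some v => simp [h2 x v hx]
  set Z := (Set.range fun f : ℕ → Fin (n + 1) => LW.map f u) ∩ As with hZdef
  have hZ : Z.Finite := hfin.subset Set.inter_subset_left
  have hD : {y | ∀ z ∈ Z, z * y ∈ As} ∈ p :=
    (Filter.eventually_all_finite hZ).2 fun z hz => hAs z hz.2
  have hw : ∃ w q, VLine τ (τ c) N w q ∧ (∀ a, sub a w ∈ {y | ∀ z ∈ Z, z * y ∈ As}) ∧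
      (τ c = t → ∀ z ∈ Z, Cb (z * sub 0 w) q) := by
    by_cases hct : τ c = t
    · have e1 := hQ _ hD N
      have e2 := (Filter.eventually_all_finite hZ).2 fun z hz => hC z hz.2
      obtain ⟨⟨w, q⟩, ⟨hv, ha⟩, hb⟩ := (e1.and e2).exists
      exact ⟨w, q, by rw [hct]; exact hv, ha, fun _ => hb⟩
    · obtain ⟨w, q, hv, ha⟩ := hp (τ c) _ hD N
      exact ⟨w, q, hv, ha, fun h => absurd h hct⟩
  obtain ⟨w, q, ⟨hq1, hq2, hq3, hq4, hq5⟩, ha, hb⟩ := hw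
  obtain ⟨M, hM⟩ := w.2
  have hmap : ∀ f : ℕ → Fin (n + 1), (∀ l : Fin (n + 1), f l = l) →
      LW.map f (u * LW.map (fun o : Option (Fin (n + 1)) => o.elim c Fin.val) w)
        = LW.map f u * sub (f c) w := by
    intro f hf
    rw [LW.map_mul, LW.map_map, sub]
    congr 2
    funext o
    cases o with
    | none => rfl
    | some l => exact hf l
  refine ⟨(u * LW.map (fun o : Option (Fin (n + 1)) => o.elim c Fin.val) w, max q M), q,
    ⟨?_, ?_, ?_⟩, hq1, le_max_left _ _, hq2, ?_, ?_, ?_, ?_⟩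
  · intro x hx
    simp only at hx
    have : N < x := by omega
    simp only [mul_val, map_val, h1 x this, hM x (by omega)]
    rfl
  · intro x v hx
    simp only [mul_val, map_val] at hx
    cases hu : u.1 x with
    | some v' =>
      rw [hu] at hx
      have := h2 x v' hu
      simp at hx
      omega
    | none =>
      rw [hu] at hx
      cases hw : w.1 x with
      | none => rw [hw] at hx; simp at hx
      | some o =>
        rw [hw] at hx
        cases o with
        | none => simp at hx; omega
        | some l => simp at hx; have := l.2; omega
  · intro f hf
    rw [hmap f hf]
    exact ha (f c) _ ⟨⟨f, rfl⟩, h3 f hf⟩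
  · intro x hx
    simp only [mul_val, map_val, hq4 x hx]
    simp
  · simp only [mul_val, map_val, hq3, h1 q hq1]
    rfl
  · intro x hx hxc
    simp only [mul_val, map_val] at hxc
    cases hu : u.1 x with
    | some v' =>
      rw [hu] at hxc
      have := h2 x v' hu
      simp at hxc
      omega
    | none =>
      rw [hu] at hxc
      cases hw : w.1 x with
      | none => rw [hw] at hxc; simp at hxc
      | some o =>
        rw [hw] at hxc
        cases o with
        | none => exact hq5 x hx hw
        | some l => simp at hxc; have := l.2; omega
  · intro hct f hf hf0
    simp only
    rw [hmap f hf, hf0]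
    exact hb hct _ ⟨⟨f, rfl⟩, h3 f hf⟩

/-- The outcome of the recursive construction. -/
theorem build {n t : ℕ} {As : Set (LW (Fin (n + 1)))} {p : Ultrafilter (LW (Fin (n + 1)))}
    (hp : ∀ s, p ∈ LI (Fin (n + 1)) τ s) (hAp : As ∈ p)
    (hAs : ∀ z ∈ As, ∀ᶠ y in (p : Filter (LW (Fin (n + 1)))), z * y ∈ As)
    {Q : Ultrafilter (LW (Option (Fin (n + 1))) × ℕ)}
    (hQ : ∀ D ∈ p, ∀ N, ∀ᶠ wq in (Q : Filter (LW (Option (Fin (n + 1))) × ℕ)),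
        VLine τ t N wq.1 wq.2 ∧ ∀ a, sub a wq.1 ∈ D)
    {Cb : LW (Fin (n + 1)) → ℕ → Prop}
    (hC : ∀ z ∈ As, ∀ᶠ wq in (Q : Filter (LW (Option (Fin (n + 1))) × ℕ)),
      Cb (z * sub 0 wq.1) wq.2) :
    ∃ (A : RG τ), Fix n A ∧ ∀ c, n < c → τ c = t → ∃ q, A q = c ∧ n < q ∧ (∀ y < q, A y < c) ∧
      ∃ u : LW ℕ, (∀ x, n < x → x < q → A x = (u.1 x).getD 0) ∧
        ∀ f : ℕ → Fin (n + 1), (∀ l : Fin (n + 1), f l = l) → f c = 0 → Cb (LW.map f u) q := by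
  classical
  have hinit : ∃ s, Inv As (n + 1) s ∧ n ≤ s.2 := by
    obtain ⟨w₀, hw₀⟩ := Filter.nonempty_of_mem hAp
    obtain ⟨M, hM⟩ := w₀.2
    refine ⟨(LW.map Fin.val w₀, max n M), ⟨?_, ?_, ?_⟩, le_max_left _ _⟩
    · intro x hx
      simp only at hx
      simp only [map_val, hM x (by omega)]
      rfl
    · intro x v hx
      simp only [map_val, Option.map_eq_some_iff] at hx
      obtain ⟨l, -, rfl⟩ := hx
      exact l.2
    · intro f hf
      simp only
      rw [LW.map_map]
      have : f ∘ Fin.val = id := funext hf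
      rw [this]
      have : LW.map id w₀ = w₀ := LW.ext' fun x => by simp [map_val]
      rwa [this]
  obtain ⟨s₀, hs₀, hn₀⟩ := hinit
  have hstep : ∀ (j : ℕ) (s : {s // Inv As (n + 1 + j) s}),
      ∃ s' : {s // Inv As (n + 1 + (j + 1)) s}, ∃ q, Step τ Cb t (n + 1 + j) s.1 s'.1 q := by
    intro j s
    obtain ⟨s', q, h1, h2⟩ := step_exists hp hAs hQ hC (c := n + 1 + j) (by omega) s.1 s.2
    exact ⟨⟨s', h1⟩, q, h2⟩
  choose nxt q hnxt using hstep
  let sq : ∀ j, {s // Inv As (n + 1 + j) s} := fun j => Nat.rec ⟨s₀, hs₀⟩ (fun j s => nxt j s) j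
  have hS : ∀ j, Step τ Cb t (n + 1 + j) (sq j).1 (sq (j + 1)).1 (q j (sq j)) :=
    fun j => hnxt j (sq j)
  set qq : ℕ → ℕ := fun j => q j (sq j) with hqq
  set U : ℕ → LW ℕ := fun j => (sq j).1.1 with hU
  set NN : ℕ → ℕ := fun j => (sq j).1.2 with hNN
  have hN0 : n ≤ NN 0 := hn₀
  have hlt : ∀ j, NN j < qq j := fun j => (hS j).1
  have hle : ∀ j, qq j ≤ NN (j + 1) := fun j => (hS j).2.1
  have htau : ∀ j, τ (qq j) = τ (n + 1 + j) := fun j => (hS j).2.2.1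
  have hst : ∀ j, ∀ x ≤ NN j, (U (j + 1)).1 x = (U j).1 x := fun j => (hS j).2.2.2.1
  have hqc : ∀ j, (U (j + 1)).1 (qq j) = some (n + 1 + j) := fun j => (hS j).2.2.2.2.1
  have hqne : ∀ j, ∀ x < qq j, (U (j + 1)).1 x ≠ some (n + 1 + j) :=
    fun j => (hS j).2.2.2.2.2.1
  have hCb := fun j => (hS j).2.2.2.2.2.2
  have hnone : ∀ j x, NN j < x → (U j).1 x = none := fun j => (sq j).2.1
  have hval : ∀ j x v, (U j).1 x = some v → v < n + 1 + j := fun j => (sq j).2.2.1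
  have hNmono : StrictMono NN := strictMono_nat_of_lt_succ fun j =>
    lt_of_lt_of_le (hlt j) (hle j)
  have hNj : ∀ j, j ≤ NN j := fun j => hNmono.le_apply
  have hst' : ∀ d j x, x ≤ NN j → (U (j + d)).1 x = (U j).1 x := by
    intro d
    induction d with
    | zero => intros; rfl
    | succ d ih =>
      intro j x hx
      rw [← add_assoc, hst (j + d) x (hx.trans (hNmono.monotone (by omega))), ih j x hx]
  have hstab : ∀ i j x, x ≤ NN i → x ≤ NN j → (U i).1 x = (U j).1 x := by
    intro i j x hi hj
    rcases le_total i j with h | h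
    · obtain ⟨d, rfl⟩ := Nat.exists_eq_add_of_le h
      exact (hst' d i x hi).symm
    · obtain ⟨d, rfl⟩ := Nat.exists_eq_add_of_le h
      exact hst' d j x hj
  set a : ℕ → ℕ := fun x => if x ≤ n then x else ((U x).1 x).getD 0 with ha
  have haU : ∀ j x, n < x → x ≤ NN j → a x = ((U j).1 x).getD 0 := by
    intro j x hx hj
    simp only [ha, if_neg (not_le.2 hx)]
    rw [hstab x j x (hNj x) hj]
  have hnq : ∀ j, n < qq j := fun j =>
    lt_of_le_of_lt (hN0.trans (hNmono.monotone (Nat.zero_le j))) (hlt j)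
  have haq : ∀ j, a (qq j) = n + 1 + j := by
    intro j
    rw [haU (j + 1) _ (hnq j) (hle j), hqc]
    rfl
  have halt : ∀ j, ∀ x < qq j, a x < n + 1 + j := by
    intro j x hx
    by_cases hxn : x ≤ n
    · simp only [ha, if_pos hxn]; omega
    · rw [haU (j + 1) _ (by omega) (hx.le.trans (hle j))]
      cases h : (U (j + 1)).1 x with
      | none => simp
      | some v =>
        have h1 := hval (j + 1) x v h
        have h2 := hqne j x hx
        rw [h] at h2
        have h3 : v ≠ n + 1 + j := fun h => h2 (by rw [h])
        simp
        omega
  have hafix : ∀ x ≤ n, a x = x := fun x hx => by simp only [ha, if_pos hx]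
  have hfirst : ∀ k, ∃ x, a x = k ∧ (∀ y < x, a y < k) ∧ τ x = τ k := by
    intro k
    by_cases hk : k ≤ n
    · exact ⟨k, hafix k hk, fun y hy => by rw [hafix y (by omega)]; exact hy, rfl⟩
    · obtain ⟨j, rfl⟩ := Nat.exists_eq_add_of_le (show n + 1 ≤ k by omega)
      exact ⟨qq j, haq j, halt j, htau j⟩
  refine ⟨⟨a, ?_, ?_, ?_⟩, hafix, ?_⟩
  · intro x k hk
    obtain ⟨y, hy, hyl, -⟩ := hfirst k
    refine ⟨y, ?_, hy⟩
    by_contra hc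
    rcases Nat.eq_or_lt_of_le (not_lt.1 hc) with h | h
    · rw [h] at hk; omega
    · have := hyl x h; omega
  · intro k
    obtain ⟨y, hy, -⟩ := hfirst k
    exact ⟨y, hy⟩
  · intro x hx
    obtain ⟨y, hy, hyl, hty⟩ := hfirst (a x)
    have : y = x := by
      rcases lt_trichotomy y x with h | h | h
      · exact absurd hy (hx y h)
      · exact h
      · exact absurd (hyl x h) (lt_irrefl _)
    rw [this] at hty
    exact hty
  · intro c hc hct
    obtain ⟨j, rfl⟩ := Nat.exists_eq_add_of_le (show n + 1 ≤ c by omega)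
    exact ⟨qq j, haq j, hnq j, halt j, U (j + 1),
      fun x hx hxq => haU (j + 1) x hx (hxq.le.trans (hle j)), hCb j hct⟩

theorem pigeon (hτ : ∀ s N, ∃ x, N < x ∧ τ x = s) : Pigeon τ := by
  classical
  intro n Ψ hΨ
  obtain ⟨p, hpp, hp⟩ := exists_good_idempotent (α := Fin (n + 1)) τ hτ
  obtain ⟨Q, hQ⟩ := exists_line_ultrafilter τ (τ (n + 1)) p (hp _)
  let C : LW (Fin (n + 1)) → ℕ → Prop := fun z q => ∃ h : RG τ, Fix n h ∧ h q = n + 1 ∧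
    (∀ i, n < i → i < q → h i = ((z.1 i).getD 0).val) ∧ Ψ h
  have hb : ∃ b : Prop, {z | ∀ᶠ wq in (Q : Filter (LW (Option (Fin (n + 1))) × ℕ)),
      (C (z * sub 0 wq.1) wq.2 ↔ b)} ∈ p := by
    by_cases h : {z | ∀ᶠ wq in (Q : Filter (LW (Option (Fin (n + 1))) × ℕ)),
      C (z * sub 0 wq.1) wq.2} ∈ p
    · exact ⟨True, by simpa only [iff_true] using h⟩
    · refine ⟨False, ?_⟩
      simp only [iff_false]
      have h' := Ultrafilter.compl_mem_iff_notMem.2 h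
      refine Filter.mem_of_superset h' ?_
      intro z hz
      exact Ultrafilter.eventually_not.2 hz
  obtain ⟨b, hA₀⟩ := hb
  set A₀ := {z | ∀ᶠ wq in (Q : Filter (LW (Option (Fin (n + 1))) × ℕ)),
      (C (z * sub 0 wq.1) wq.2 ↔ b)} with hA₀def
  have hmul : ∀ D ∈ p, ∀ᶠ x in (p : Filter (LW (Fin (n + 1)))),
      ∀ᶠ y in (p : Filter (LW (Fin (n + 1)))), x * y ∈ D := by
    intro D hD
    refine (Ultrafilter.eventually_mul p p (· ∈ D)).1 ?_
    rw [hpp]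
    exact hD
  set As := {z | z ∈ A₀ ∧ ∀ᶠ y in (p : Filter (LW (Fin (n + 1)))), z * y ∈ A₀} with hAsdef
  have hAsp : As ∈ p := Filter.inter_mem hA₀ (hmul _ hA₀)
  have hAs : ∀ z ∈ As, ∀ᶠ y in (p : Filter (LW (Fin (n + 1)))), z * y ∈ As := by
    intro z hz
    have h1 := hz.2
    have h2 := hmul _ hz.2
    filter_upwards [h1, h2] with y hy1 hy2
    refine ⟨hy1, ?_⟩
    filter_upwards [hy2] with x hx
    rw [mul_assoc]
    exact hx
  obtain ⟨A, hAn, hA⟩ := build (τ := τ) (t := τ (n + 1)) hp hAsp hAs hQ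
    (Cb := fun z q => (C z q ↔ b)) (fun z hz => hz.1)
  have key : ∀ f : RG τ, Fix n f → (Ψ (f * A) ↔ b) := by
    intro f hf
    obtain ⟨c, hfc, hcl⟩ := f.exists_first' (n + 1)
    have hcn : n < c := by
      by_contra h
      have := hf c (by omega)
      omega
    have hct : τ c = τ (n + 1) := by
      have := f.typ c (fun y hy => by have := hcl y hy; omega)
      rw [this, hfc]
    obtain ⟨q, hq, hnq, hql, u, hu, hCb⟩ := hA c hcn hct
    let g : ℕ → Fin (n + 1) := fun i => if h : i < c then ⟨f i, hcl i h⟩ else 0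
    have hg1 : ∀ l : Fin (n + 1), g l = l := by
      intro l
      have hl := l.2
      simp only [g, dif_pos (show (l : ℕ) < c by omega)]
      exact Fin.ext (hf l (by omega))
    have hg2 : g c = 0 := by simp [g]
    have h0 := hCb g hg1 hg2
    have hgu : ∀ i, n < i → i < q → f (A i) = (((LW.map g u).1 i).getD 0).val := by
      intro i hi hiq
      have h1 := hu i hi hiq
      have h2 := hql i hiq
      rw [h1] at h2
      rw [h1, map_val]
      cases h : u.1 i with
      | none => simp [hf 0 (Nat.zero_le _)]
      | some v =>
        rw [h] at h2
        simp only [Option.getD_some] at h2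
        simp [g, h2]
    rw [← h0]
    constructor
    · intro h
      exact ⟨f * A, hf.mul hAn, by rw [mul_apply, hq, hfc], hgu, h⟩
    · rintro ⟨h, hh1, hh2, hh3, hh4⟩
      refine hΨ h (f * A) ⟨q, hh2, by rw [mul_apply, hq, hfc], ?_⟩ hh4
      intro y hy
      by_cases hyn : y ≤ n
      · rw [hh1 y hyn, (hf.mul hAn) y hyn]
        exact ⟨rfl, by omega⟩
      · rw [mul_apply, hgu y (by omega) hy, hh3 y (by omega) hy]
        exact ⟨rfl, Fin.is_lt _⟩
  refine ⟨A, hAn, ?_⟩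
  by_cases hbb : b
  · exact Or.inl fun f hf => (key f hf).2 hbb
  · exact Or.inr fun f hf h => hbb ((key f hf).1 h)

end RG

/-! ### Equivalence relations and rigid surjections -/

/-- Rigid surjections as plain functions. -/
def RS (f : ℕ → ℕ) : Prop := (∀ x j, j < f x → ∃ y < x, f y = j) ∧ ∀ k, ∃ x, f x = k

theorem RS.pRep {f : ℕ → ℕ} (hf : RS f) {k p : ℕ} (hp : f p = k) (hlt : ∀ y < p, f y < k) :
    pRep (Setoid.ker f) k = p := by
  choose Q hQ1 hQ2 using RG.exists_first hf.1 hf.2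
  have hmono : StrictMono Q := by
    intro i j hij
    by_contra hc
    rcases Nat.eq_or_lt_of_le (not_lt.1 hc) with h | h
    · have h1 := hQ1 i
      have h2 := hQ1 j
      rw [h] at h2
      omega
    · have h1 := hQ2 i _ h
      rw [hQ1] at h1
      omega
  have hrange : Set.range Q = minReps (Setoid.ker f) := by
    ext x
    constructor
    · rintro ⟨i, rfl⟩ m hm
      have hm' : f (Q i) = f m := hm
      by_contra hc
      have := hQ2 i m (not_le.1 hc)
      rw [← hm', hQ1] at this
      omega
    · intro hx
      refine ⟨f x, ?_⟩
      have h1 : x ≤ Q (f x) := hx _ (show f x = f (Q (f x)) from (hQ1 _).symm)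
      rcases Nat.eq_or_lt_of_le h1 with h | h
      · exact h.symm
      · exact absurd (hQ2 (f x) x h) (lt_irrefl _)
  have hinf : (setOf (· ∈ minReps (Setoid.ker f))).Infinite := by
    change (minReps (Setoid.ker f)).Infinite
    rw [← hrange]
    exact Set.infinite_range_of_injective hmono.injective
  have hnth : Nat.nth (· ∈ minReps (Setoid.ker f)) = Q := by
    refine ((Nat.nth_strictMono hinf).range_inj hmono).1 ?_
    rw [Nat.range_nth_of_infinite hinf, hrange]
    rfl
  rw [DualRamsey.pRep, hnth]
  rcases lt_trichotomy (Q k) p with h | h | h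
  · have := hlt _ h
    rw [hQ1] at this
    omega
  · exact h
  · have := hQ2 k p h
    omega

theorem RS.classes_infinite {f : ℕ → ℕ} (hf : RS f) : (classes (Setoid.ker f)).Infinite := by
  refine Set.infinite_of_injective_forall_mem (f := fun k : ℕ => {y | k = f y}) ?_ ?_
  · intro i j hij
    obtain ⟨x, hx⟩ := hf.2 i
    have : x ∈ {y | i = f y} := hx.symm
    simp only at hij
    rw [hij] at this
    have h2 : j = f x := this
    omega
  · intro k
    obtain ⟨x, hx⟩ := hf.2 k
    refine ⟨x, ?_⟩
    ext y
    change k = f y ↔ f x = f y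
    rw [hx]

theorem exists_index (E : Setoid ℕ) (hE : (classes E).Infinite) :
    ∃ e, RS e ∧ Setoid.ker e = E := by
  classical
  have hex : ∀ x, ∃ m, E.r x m := fun x => ⟨x, E.refl' x⟩
  let mr : ℕ → ℕ := fun x => Nat.find (hex x)
  have hmr : ∀ x, E.r x (mr x) := fun x => Nat.find_spec (hex x)
  have hmin : ∀ x y, E.r x y → mr x ≤ y := fun x y h => Nat.find_min' (hex x) h
  have hmem : ∀ x, mr x ∈ minReps E := by
    intro x y hy
    exact hmin x y (E.trans' (hmr x) hy)
  have hfix : ∀ x ∈ minReps E, mr x = x := fun x hx =>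
    le_antisymm (hmin x x (E.refl' x)) (hx _ (hmr x))
  have hinf : (setOf (· ∈ minReps E)).Infinite := by
    change (minReps E).Infinite
    intro hfin
    apply hE
    refine (hfin.image (fun n => {y | E.r n y})).subset ?_
    rintro _ ⟨x, rfl⟩
    refine ⟨mr x, hmem x, ?_⟩
    ext y
    exact ⟨fun h => E.trans' (hmr x) h, fun h => E.trans' (E.symm' (hmr x)) h⟩
  have hnm : ∀ k, Nat.nth (· ∈ minReps E) k ∈ minReps E := fun k => Nat.nth_mem_of_infinite hinf k
  have hcn : ∀ k, Nat.count (· ∈ minReps E) (Nat.nth (· ∈ minReps E) k) = k :=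
    fun k => Nat.count_nth_of_infinite hinf k
  refine ⟨fun x => Nat.count (· ∈ minReps E) (mr x), ⟨?_, ?_⟩, ?_⟩
  · intro x j hj
    refine ⟨Nat.nth (· ∈ minReps E) j, ?_, ?_⟩
    · exact lt_of_lt_of_le (Nat.nth_lt_of_lt_count hj) (hmin x x (E.refl' x))
    · simp only [hfix _ (hnm j)]
      exact hcn j
  · intro k
    refine ⟨Nat.nth (· ∈ minReps E) k, ?_⟩
    simp only [hfix _ (hnm k)]
    exact hcn k
  · ext x y
    change Nat.count (· ∈ minReps E) (mr x) = Nat.count (· ∈ minReps E) (mr y) ↔ E.r x y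
    constructor
    · intro h
      have := Nat.count_injective (hmem x) (hmem y) h
      have h2 := hmr y
      rw [← this] at h2
      exact E.trans' (hmr x) (E.symm' h2)
    · intro h
      have : mr x = mr y := le_antisymm (hmin x _ (E.trans' h (hmr y)))
        (hmin y _ (E.trans' (E.symm' h) (hmr x)))
      rw [this]

theorem RS.mem {P : ℕ → Set ℕ} {f : ℕ → ℕ} (hf : RS f)
    (h : ∀ x, (∀ y < x, f y < f x) → x ∈ P (sigmaSeq (f x))) :
    Setoid.ker f ∈ EPaltInf P := by
  refine ⟨hf.classes_infinite, fun k => ?_⟩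
  obtain ⟨p, hp, hlt⟩ := RG.exists_first hf.1 hf.2 k
  rw [hf.pRep hp hlt]
  have := h p (by rw [hp]; exact hlt)
  rwa [hp] at this

theorem RS.of_mem {P : ℕ → Set ℕ} {f : ℕ → ℕ} (hf : RS f) (hm : Setoid.ker f ∈ EPaltInf P)
    {x : ℕ} (hx : ∀ y < x, f y < f x) : x ∈ P (sigmaSeq (f x)) := by
  have := hm.2 (f x)
  rwa [hf.pRep rfl hx] at this

theorem RS.comp {e : ℕ → ℕ} (he : RS e) (g : RG sigmaSeq) : RS (fun x => g (e x)) := by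
  constructor
  · intro x j hj
    obtain ⟨c, hc, rfl⟩ := g.rigid _ _ hj
    obtain ⟨y, hy, rfl⟩ := he.1 _ _ hc
    exact ⟨y, hy, rfl⟩
  · intro k
    obtain ⟨c, rfl⟩ := g.surj k
    obtain ⟨x, rfl⟩ := he.2 c
    exact ⟨x, rfl⟩

theorem RS.comp_mem {P : ℕ → Set ℕ} {e : ℕ → ℕ} (he : RS e) (hm : Setoid.ker e ∈ EPaltInf P)
    (g : RG sigmaSeq) : Setoid.ker (fun x => g (e x)) ∈ EPaltInf P := by
  refine (he.comp g).mem fun x hx => ?_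
  have h1 : ∀ y < x, e y < e x := by
    refine RG.rigid_lt_of_first he.1 fun y hy h => ?_
    have := hx y hy
    simp only [h] at this
    omega
  have h2 := g.typ (e x) (by
    intro c hc
    obtain ⟨y, hy, rfl⟩ := he.1 _ _ hc
    exact (hx y hy).ne)
  have h3 := he.of_mem hm h1
  rwa [h2] at h3

theorem RS.factor {P : ℕ → Set ℕ} (hdisj : ∀ i j, i ≠ j → Disjoint (P i) (P j))
    {k : ℕ → ℕ} (hk : RS k) (hm : Setoid.ker k ∈ EPaltInf P) {F : Setoid ℕ}
    (hF : F ∈ EPaltInf P) (hFk : Coarsens F (Setoid.ker k)) :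
    ∃ h : RG sigmaSeq, Setoid.ker (fun x => h (k x)) = F := by
  obtain ⟨f, hf, rfl⟩ := exists_index F hF.1
  choose Q hQ1 hQ2 using RG.exists_first hk.1 hk.2
  have hh : ∀ x, f (Q (k x)) = f x := fun x =>
    hFk (Q (k x)) x (show k (Q (k x)) = k x from hQ1 _)
  refine ⟨⟨fun c => f (Q c), ?_, ?_, ?_⟩, ?_⟩
  · intro c j hj
    obtain ⟨y, hy, rfl⟩ := hf.1 _ _ hj
    exact ⟨k y, hQ2 c y hy, hh y⟩
  · intro j
    obtain ⟨x, rfl⟩ := hf.2 j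
    exact ⟨k x, hh x⟩
  · intro c hc
    have h1 : Q c ∈ P (sigmaSeq (f (Q c))) := by
      refine hf.of_mem hF (RG.rigid_lt_of_first hf.1 fun y hy => ?_)
      rw [← hh y]
      exact hc _ (hQ2 c y hy)
    have h2 : Q c ∈ P (sigmaSeq (k (Q c))) := by
      refine hk.of_mem hm ?_
      rw [hQ1]
      exact hQ2 c
    rw [hQ1] at h2
    by_contra hne
    exact Set.disjoint_left.1 (hdisj _ _ hne) h2 h1
  · congr 1
    funext x
    exact hh x

theorem sigmaSeq_unbounded (s N : ℕ) : ∃ x, N < x ∧ sigmaSeq x = s := by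
  have hpos : 0 < 2 ^ s := Nat.two_pow_pos s
  refine ⟨2 ^ s * (2 * N + 3) - 1, ?_, ?_⟩
  · have : 1 * (2 * N + 3) ≤ 2 ^ s * (2 * N + 3) := Nat.mul_le_mul_right _ hpos
    omega
  · have h1 : 2 ^ s * (2 * N + 3) - 1 + 1 = 2 ^ s * (2 * N + 3) :=
      Nat.sub_add_cancel (Nat.mul_pos hpos (by omega))
    rw [sigmaSeq, h1, padicValNat.mul hpos.ne' (by omega), padicValNat.prime_pow,
      padicValNat.eq_zero_of_not_dvd (by omega)]
    rfl

/-- The parametrisation of the coarsenings of `ker e`. -/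
def Phi {P : ℕ → Set ℕ} {e : ℕ → ℕ} (he : RS e) (hm : Setoid.ker e ∈ EPaltInf P)
    (g : RG sigmaSeq) : ↥(EPaltInf P) := ⟨Setoid.ker (fun x => g (e x)), he.comp_mem hm g⟩

theorem approx_Phi {P : ℕ → Set ℕ} {e : ℕ → ℕ} (he : RS e) (hm : Setoid.ker e ∈ EPaltInf P)
    (g f : RG sigmaSeq) (n : ℕ) (hf : RG.Fix n f) :
    approx n (Phi he hm (f * g)).1 = approx n (Phi he hm g).1 := by
  obtain ⟨p, hp, hlt⟩ := RG.exists_first (he.comp g).1 (he.comp g).2 n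
  have h1 : pRep (Phi he hm g).1 n = p := (he.comp g).pRep hp hlt
  have h2 : pRep (Phi he hm (f * g)).1 n = p := by
    refine (he.comp (f * g)).pRep ?_ ?_
    · change f (g (e p)) = n
      rw [hp]
      exact hf n le_rfl
    · intro y hy
      change f (g (e y)) < n
      have := hlt y hy
      rw [hf _ this.le]
      exact this
  ext ⟨x, y⟩
  simp only [approx, h1, h2]
  constructor
  · rintro ⟨hx, hy, hr⟩
    refine ⟨hx, hy, ?_⟩
    have hr' : f (g (e x)) = f (g (e y)) := hr
    rw [hf _ (hlt x hx).le, hf _ (hlt y hy).le] at hr'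
    exact hr'
  · rintro ⟨hx, hy, hr⟩
    exact ⟨hx, hy, congrArg f hr⟩

theorem isOp_preimage {P : ℕ → Set ℕ} {e : ℕ → ℕ} (he : RS e) (hm : Setoid.ker e ∈ EPaltInf P)
    (U : Set ↥(EPaltInf P)) (hU : (ellentuckTop (EPaltInf P)).IsOpen U) :
    RG.IsOp {g | Phi he hm g ∈ U} := by
  have hU' : TopologicalSpace.GenerateOpen {U | ∃ a E, U = basicSet (EPaltInf P) a E} U := hU
  clear hU
  induction hU' with
  | basic U hU =>
    obtain ⟨a, B, rfl⟩ := hU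
    rintro g ⟨hg, n, hn⟩
    refine ⟨n, fun f hf => ⟨fun x y hxy => ?_, n, ?_⟩⟩
    · have : g (e x) = g (e y) := hg x y hxy
      exact congrArg f this
    · rw [approx_Phi he hm g f n hf]
      exact hn
  | univ => exact fun g _ => ⟨0, fun f _ => Set.mem_univ _⟩
  | inter U V _ _ ihU ihV =>
    rintro g ⟨h1, h2⟩
    obtain ⟨m1, hm1⟩ := ihU g h1
    obtain ⟨m2, hm2⟩ := ihV g h2
    exact ⟨max m1 m2, fun f hf => ⟨hm1 f (hf.mono (le_max_left _ _)),
      hm2 f (hf.mono (le_max_right _ _))⟩⟩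
  | sUnion S _ ih =>
    rintro g ⟨U, hU, hg⟩
    obtain ⟨m, hm⟩ := ih U hU g hg
    exact ⟨m, fun f hf => ⟨U, hU, hm f hf⟩⟩

theorem cr_preimage {P : ℕ → Set ℕ} {e : ℕ → ℕ} (he : RS e) (hm : Setoid.ker e ∈ EPaltInf P)
    (X : Set ↥(EPaltInf P)) (hX : SouslinMeasurable (ellentuckTop (EPaltInf P)) X) :
    RG.CR {g | Phi he hm g ∈ X} := by
  have hP := RG.pigeon sigmaSeq_unbounded
  refine hX {X | RG.CR {g | Phi he hm g ∈ X}} ?_ ?_ ?_ ?_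
  · intro U hU
    exact RG.cr_of_open sigmaSeq_unbounded hP (isOp_preimage he hm U hU)
  · intro A hA
    exact RG.CR.compl hA
  · intro A hA B hB
    exact RG.CR.union hA hB
  · intro f hf
    have := RG.cr_souslin sigmaSeq_unbounded hP (fun s => {g | Phi he hm g ∈ f s}) hf
    have heq : {g | Phi he hm g ∈ souslinOp f}
        = souslinOp (fun s => {g | Phi he hm g ∈ f s}) := by
      ext g
      simp [souslinOp]
    change RG.CR {g | Phi he hm g ∈ souslinOp f}
    rw [heq]
    exact this

/-- **Corollary 5.2:** for every finite Souslin measurable colouring of `𝓔^P_∞`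
(`P` an infinite partition) and every `E` in the space, there is a coarsening
`F ≤ E` in the space such that the colouring is constant on `𝓔^P_∞ ↾ F`. -/
theorem EPaltInfSouslinColouring
    (P : ℕ → Set ℕ)
    (hinf : ∀ i, (P i).Infinite)
    (hdisj : ∀ i j, i ≠ j → Disjoint (P i) (P j))
    (hcov : ⋃ i, P i = Set.univ)
    (hmin : ∀ i j : ℕ, i < j → sInf (P i) < sInf (P j))
    (m : ℕ) (c : ↥(EPaltInf P) → Fin m)
    (hc : ∀ i : Fin m, SouslinMeasurable (ellentuckTop (EPaltInf P)) {E | c E = i})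
    (E : ↥(EPaltInf P)) :
    ∃ F : ↥(EPaltInf P), Coarsens F.1 E.1 ∧
      ∀ F₁ F₂ : ↥(EPaltInf P), Coarsens F₁.1 F.1 → Coarsens F₂.1 F.1 → c F₁ = c F₂ := by
  obtain ⟨E, hE⟩ := E
  obtain ⟨e, he, rfl⟩ := exists_index E hE.1
  obtain ⟨A, -, hA⟩ := RG.finset_tasks (Finset.univ : Finset (Fin m))
    (fun i B => (∀ f : RG sigmaSeq, c (Phi he hE (f * B)) = i) ∨
      (∀ f : RG sigmaSeq, c (Phi he hE (f * B)) ≠ i)) 0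
    (by
      intro i B A _ h
      rcases h with h | h
      · exact Or.inl fun f => by rw [← mul_assoc]; exact h _
      · exact Or.inr fun f => by rw [← mul_assoc]; exact h _)
    (by
      intro i B
      obtain ⟨A, hA, h⟩ := cr_preimage he hE _ (hc i) 0 B
      refine ⟨A, hA, ?_⟩
      rcases h with h | h
      · exact Or.inl fun f => h f (RG.fix_zero f)
      · exact Or.inr fun f => h f (RG.fix_zero f)) 1
  rw [mul_one] at hA
  have hconst : ∀ f, c (Phi he hE (f * A)) = c (Phi he hE A) := by
    intro f
    rcases hA (c (Phi he hE A)) (Finset.mem_univ _) with h | h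
    · exact h f
    · exact absurd (congrArg (fun B => c (Phi he hE B)) (one_mul A)) (h 1)
  have hall : ∀ F : ↥(EPaltInf P), Coarsens F.1 (Phi he hE A).1 → c F = c (Phi he hE A) := by
    intro F hF
    obtain ⟨h, hh⟩ := RS.factor hdisj (he.comp A) (Phi he hE A).2 F.2 hF
    rw [← hconst h]
    congr 1
    exact Subtype.ext hh.symm
  refine ⟨Phi he hE A, fun x y hxy => congrArg A hxy, fun F₁ F₂ h1 h2 => ?_⟩
  rw [hall F₁ h1, hall F₂ h2]

end DualRamsey
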